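/- arXiv:1708.05149 — 2 statements merged into one kernel-verified Lean document; each statement's English description precedes it below -/
import Mathlib

section
/- There exists an absolute constant c > 0 such that the following holds. Let f : ℝⁿ → ℝ be Lipschitz with |f(x) − f(y)| ≤ b‖x − y‖₂ and |f(x) − f(y)| ≤ a‖x − y‖_∞ for all x, y ∈ ℝⁿ, and suppose that ∫ |∂ᵢ f| dγₙ ≤ A for every i = 1, …, n. Then for all t > 0, P( |f(G) − E f(G)| > t ) ≤ 4 exp( −c · max{ t²/b², (t/b)·√(log(e + b²/(aA))) } ), where G is a standard n-dimensional Gaussian vector. -/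
open MeasureTheory ProbabilityTheory Real

/-- The standard Gaussian measure `γₙ` on `ℝⁿ`. -/
noncomputable def stdGaussian (n : ℕ) : Measure (Fin n → ℝ) :=
  Measure.pi fun _ => gaussianReal 0 1

/-- The Euclidean norm on `ℝⁿ`. -/
noncomputable def euclNorm {n : ℕ} (x : Fin n → ℝ) : ℝ :=
  Real.sqrt (∑ i, (x i) ^ 2)

/-- The `i`-th partial derivative of `f : ℝⁿ → ℝ` (defined via the Fréchet derivative;
for a Lipschitz `f` this agrees a.e. with the usual partial derivative by Rademacher). -/
noncomputable def partialDeriv {n : ℕ} (f : (Fin n → ℝ) → ℝ) (i : Fin n)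
    (x : Fin n → ℝ) : ℝ :=
  fderiv ℝ f x (Pi.single i 1)

namespace GaussianDeviation

instance isProbabilityMeasure_stdGaussian (n : ℕ) :
    IsProbabilityMeasure (_root_.stdGaussian n) := by
  unfold _root_.stdGaussian; infer_instance

instance isGaussian_stdGaussian (n : ℕ) : IsGaussian (_root_.stdGaussian n) := by
  have h : (ProbabilityTheory.stdGaussian (EuclideanSpace ℝ (Fin n))).map
      (EuclideanSpace.equiv (Fin n) ℝ) = _root_.stdGaussian n := by
    rw [← map_pi_eq_stdGaussian, Measure.map_map (by fun_prop) (by fun_prop)]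
    exact Measure.map_id
  rw [← h]
  infer_instance

lemma integral_id_stdGaussian (n : ℕ) : (_root_.stdGaussian n)[id] = 0 := by
  ext i
  have h := (ContinuousLinearMap.proj (R := ℝ) (φ := fun _ : Fin n ↦ ℝ) i).integral_comp_id_comm
    (IsGaussian.integrable_id (μ := _root_.stdGaussian n))
  simp only [ContinuousLinearMap.proj_apply] at h
  simp only [id, Pi.zero_apply]
  rw [← h, _root_.stdGaussian, integral_eval]
  simp

lemma measurePreserving_rotation {E : Type*} [NormedAddCommGroup E] [NormedSpace ℝ E]
    [MeasurableSpace E] [BorelSpace E] [SecondCountableTopology E] [CompleteSpace E]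
    {μ : Measure E} [IsGaussian μ] (hμ : μ[id] = 0) (θ : ℝ) :
    MeasurePreserving (fun p : E × E ↦
      (cos θ • p.1 + sin θ • p.2, -sin θ • p.1 + cos θ • p.2)) (μ.prod μ) (μ.prod μ) :=
  ⟨by fun_prop, IsGaussian.map_rotation_eq_self hμ θ⟩

lemma measurePreserving_rot_stdGaussian (n : ℕ) (θ : ℝ) :
    MeasurePreserving (fun p : (Fin n → ℝ) × (Fin n → ℝ) ↦
      (cos θ • p.1 + sin θ • p.2, -sin θ • p.1 + cos θ • p.2))
      ((_root_.stdGaussian n).prod (_root_.stdGaussian n))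
      ((_root_.stdGaussian n).prod (_root_.stdGaussian n)) :=
  measurePreserving_rotation (integral_id_stdGaussian n) θ

lemma measurePreserving_rot_gaussianReal (θ : ℝ) :
    MeasurePreserving (fun p : ℝ × ℝ ↦
      (cos θ • p.1 + sin θ • p.2, -sin θ • p.1 + cos θ • p.2))
      ((gaussianReal 0 1).prod (gaussianReal 0 1))
      ((gaussianReal 0 1).prod (gaussianReal 0 1)) :=
  measurePreserving_rotation (by simp) θ

lemma map_sum_mul_stdGaussian {n : ℕ} (v : Fin n → ℝ) :
    (_root_.stdGaussian n).map (fun y ↦ ∑ i, v i * y i)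
      = gaussianReal 0 (∑ i, v i ^ 2).toNNReal := by
  apply Measure.ext_of_charFun
  ext t
  rw [charFun_apply_real, integral_map
    (Finset.measurable_sum _ fun i _ ↦ (measurable_pi_apply i).const_mul _).aemeasurable
    (by fun_prop), charFun_gaussianReal]
  simp only [Complex.ofReal_sum, Finset.mul_sum, Finset.sum_mul, Complex.exp_sum]
  rw [_root_.stdGaussian, integral_fintype_prod_eq_prod
    (f := fun i (x:ℝ) ↦ Complex.exp (t * ((v i * x : ℝ) : ℂ) * Complex.I))]
  have : ∀ i, ∫ x : ℝ, Complex.exp (t * ((v i * x : ℝ) : ℂ) * Complex.I) ∂gaussianReal 0 1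
      = Complex.exp (-(t ^ 2 * (v i) ^2 / 2)) := by
    intro i
    have := charFun_gaussianReal (μ := 0) (v := 1) (t * v i)
    rw [charFun_apply_real] at this
    convert this using 1
    · simp [mul_assoc]
    · push_cast; congr 1; ring_nf
  simp_rw [this, ← Complex.exp_sum]
  rw [Real.coe_toNNReal _ (Finset.sum_nonneg fun i _ => sq_nonneg _)]
  congr 1
  push_cast
  simp only [Finset.sum_neg_distrib, Finset.sum_mul, Finset.sum_div]
  simp [mul_comm]

lemma stdGaussian_absolutelyContinuous (n : ℕ) : _root_.stdGaussian n ≪ volume := by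
  induction n with
  | zero =>
    rw [_root_.stdGaussian, volume_pi, Measure.pi_of_empty, Measure.pi_of_empty]
  | succ n ih =>
    have h1 := (measurePreserving_piFinSuccAbove (n := n) (fun _ => gaussianReal 0 1) 0).symm
    have h2 := (volume_preserving_piFinSuccAbove (n := n) (fun _ => ℝ) 0).symm
    rw [_root_.stdGaussian, ← h1.map_eq, ← h2.map_eq]
    refine Measure.AbsolutelyContinuous.map (Measure.AbsolutelyContinuous.prod
      (gaussianReal_absolutelyContinuous 0 one_ne_zero) ih) (MeasurableEquiv.measurable _)

lemma measurePreserving_insertNth {n : ℕ} (i : Fin (n + 1)) :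
    MeasurePreserving (fun p : ℝ × (Fin n → ℝ) ↦ (i.insertNth p.1 p.2 : Fin (n + 1) → ℝ))
      ((gaussianReal 0 1).prod (_root_.stdGaussian n)) (_root_.stdGaussian (n + 1)) :=
  (measurePreserving_piFinSuccAbove (n := n) (fun _ => gaussianReal 0 1) i).symm

lemma measurePreserving_cons (n : ℕ) :
    MeasurePreserving (fun p : ℝ × (Fin n → ℝ) ↦ (Fin.cons p.1 p.2 : Fin (n + 1) → ℝ))
      ((gaussianReal 0 1).prod (_root_.stdGaussian n)) (_root_.stdGaussian (n + 1)) := by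
  simpa [Fin.insertNth_zero] using measurePreserving_insertNth (n := n) 0

lemma measurable_fderiv_apply {Ω : Type*} [MeasurableSpace Ω] {n : ℕ} (g : (Fin n → ℝ) → ℝ)
    {u v : Ω → Fin n → ℝ} (hu : Measurable u) (hv : Measurable v) :
    Measurable fun ω ↦ fderiv ℝ g (u ω) (v ω) := by
  have h : ∀ ω, fderiv ℝ g (u ω) (v ω) = ∑ i, v ω i * fderiv ℝ g (u ω) (Pi.single i 1) := by
    intro ω
    conv_lhs => rw [pi_eq_sum_univ' (v ω)]
    simp [map_sum]
  simp_rw [h]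
  refine Finset.measurable_sum _ fun i _ ↦ ?_
  exact ((measurable_pi_apply i).comp hv).mul ((measurable_fderiv_apply_const ℝ g _).comp hu)

lemma norm_fderiv_apply_le {n : ℕ} {g : (Fin n → ℝ) → ℝ} {K : NNReal} (hg : LipschitzWith K g)
    (x y : Fin n → ℝ) : |fderiv ℝ g x y| ≤ K * ‖y‖ :=
  (fderiv ℝ g x).le_of_opNorm_le (norm_fderiv_le_of_lipschitz ℝ hg) y

/-- Jensen's inequality for the increment of a Lipschitz function along a differentiable curve. -/
lemma ofReal_convex_increment_le {n : ℕ} {g : (Fin n → ℝ) → ℝ} {K : NNReal}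
    (hg : LipschitzWith K g) {c c' : ℝ → Fin n → ℝ} (hc : ∀ s, HasDerivAt c (c' s) s)
    (hc' : Continuous c') {Ψ : ℝ → ℝ} (hΨ : ConvexOn ℝ Set.univ Ψ) (hΨ0 : ∀ x, 0 ≤ Ψ x)
    {θ : ℝ} (hθ : 0 < θ)
    (hdiff : ∀ᵐ s ∂(volume.restrict (Set.Ioc 0 θ)), DifferentiableAt ℝ g (c s)) :
    ENNReal.ofReal (Ψ (g (c θ) - g (c 0))) ≤
      (ENNReal.ofReal θ)⁻¹ *
        ∫⁻ s in Set.Ioc 0 θ, ENNReal.ofReal (Ψ (θ * fderiv ℝ g (c s) (c' s))) := by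
  have hΨc : Continuous Ψ := by
    rw [← continuousOn_univ]
    exact hΨ.continuousOn isOpen_univ
  have hcc : Continuous c := continuous_iff_continuousAt.2 fun s ↦ (hc s).continuousAt
  obtain ⟨B, hB⟩ := (isCompact_Icc (a := (0 : ℝ)) (b := θ)).exists_bound_of_continuousOn
    hc'.continuousOn
  have hB0 : 0 ≤ B := (norm_nonneg _).trans (hB 0 ⟨le_rfl, hθ.le⟩)
  have hlip : LipschitzOnWith (K * B.toNNReal) (fun s ↦ g (c s)) (Set.uIcc 0 θ) := by
    rw [Set.uIcc_of_le hθ.le]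
    refine hg.comp_lipschitzOnWith ?_
    refine (convex_Icc 0 θ).lipschitzOnWith_of_nnnorm_hasDerivWithin_le
      (fun s _ ↦ (hc s).hasDerivWithinAt) fun s hs ↦ ?_
    rw [← NNReal.coe_le_coe, coe_nnnorm, Real.coe_toNNReal _ hB0]
    exact hB s hs
  have hac := hlip.absolutelyContinuousOnInterval
  set L : ℝ → ℝ := fun s ↦ fderiv ℝ g (c s) (c' s) with hL
  have hLm : Measurable L := measurable_fderiv_apply g hcc.measurable hc'.measurable
  have hderiv : ∀ᵐ s ∂(volume.restrict (Set.Ioc 0 θ)), deriv (fun s ↦ g (c s)) s = L s := by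
    filter_upwards [hdiff] with s hs
    exact (hs.hasFDerivAt.comp_hasDerivAt s (hc s)).deriv
  have hint : ∫ s in Set.Ioc 0 θ, L s = g (c θ) - g (c 0) := by
    rw [← hac.integral_deriv_eq_sub, intervalIntegral.integral_of_le hθ.le]
    exact integral_congr_ae (hderiv.mono fun s hs ↦ hs.symm)
  have hLb : ∀ s ∈ Set.Ioc 0 θ, |θ * L s| ≤ θ * (K * B) := by
    intro s hs
    rw [abs_mul, abs_of_pos hθ]
    refine mul_le_mul_of_nonneg_left ((norm_fderiv_apply_le hg _ _).trans ?_) hθ.le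
    exact mul_le_mul_of_nonneg_left (hB s ⟨hs.1.le, hs.2⟩) K.2
  have hfin : volume (Set.Ioc 0 θ) ≠ ⊤ := by simp
  have hLi : IntegrableOn (fun s ↦ θ * L s) (Set.Ioc 0 θ) := by
    refine Measure.integrableOn_of_bounded (M := θ * (K * B)) hfin
      (hLm.const_mul θ).aestronglyMeasurable ?_
    filter_upwards [ae_restrict_mem measurableSet_Ioc] with s hs using hLb s hs
  obtain ⟨C, hC⟩ := (isCompact_Icc (a := -(θ * (K * B))) (b := θ * (K * B))
    ).exists_bound_of_continuousOn hΨc.continuousOn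
  have hΨi : IntegrableOn (Ψ ∘ fun s ↦ θ * L s) (Set.Ioc 0 θ) := by
    refine Measure.integrableOn_of_bounded (M := C) hfin
      (hΨc.measurable.comp (hLm.const_mul θ)).aestronglyMeasurable ?_
    filter_upwards [ae_restrict_mem measurableSet_Ioc] with s hs
    exact hC _ (abs_le.1 (hLb s hs))
  have hJ := hΨ.map_set_average_le hΨc.continuousOn isClosed_univ (μ := volume)
    (t := Set.Ioc 0 θ) (by simp [hθ]) hfin (by simp) hLi hΨi
  simp only [setAverage_eq, Measure.real, Real.volume_Ioc, sub_zero, ENNReal.toReal_ofReal hθ.le,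
    smul_eq_mul, integral_const_mul, hint, inv_mul_cancel_left₀ hθ.ne'] at hJ
  refine (ENNReal.ofReal_le_ofReal hJ).trans_eq ?_
  rw [ENNReal.ofReal_mul (by positivity), ENNReal.ofReal_inv_of_pos hθ]
  congr 1
  exact ofReal_integral_eq_lintegral_ofReal hΨi (Filter.Eventually.of_forall fun _ ↦ hΨ0 _)

/-- Interpolation along a family of measure-preserving maps: convex functionals of the increments
of a Lipschitz function are controlled by those of its derivative. -/
lemma lintegral_convex_increment_le {Ω : Type*} [MeasurableSpace Ω] {ν : Measure Ω} [SFinite ν]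
    {R : ℝ → Ω → Ω} (hRm : Measurable (Function.uncurry R))
    (hR : ∀ s, MeasurePreserving (R s) ν ν) {n : ℕ} {p p' : Ω → Fin n → ℝ}
    (hp : Measurable p) (hp' : Measurable p')
    (hc : ∀ ω s, HasDerivAt (fun s ↦ p (R s ω)) (p' (R s ω)) s)
    (hc' : ∀ ω, Continuous fun s ↦ p' (R s ω))
    {g : (Fin n → ℝ) → ℝ} {K : NNReal} (hg : LipschitzWith K g)
    (hdiff : ∀ᵐ ω ∂ν, DifferentiableAt ℝ g (p ω))
    {Ψ : ℝ → ℝ} (hΨ : ConvexOn ℝ Set.univ Ψ) (hΨ0 : ∀ x, 0 ≤ Ψ x) {θ : ℝ} (hθ : 0 < θ) :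
    ∫⁻ ω, ENNReal.ofReal (Ψ (g (p (R θ ω)) - g (p (R 0 ω)))) ∂ν ≤
      ∫⁻ ω, ENNReal.ofReal (Ψ (θ * fderiv ℝ g (p ω) (p' ω))) ∂ν := by
  have hΨc : Continuous Ψ := by
    rw [← continuousOn_univ]
    exact hΨ.continuousOn isOpen_univ
  have hFm : Measurable fun ω ↦ ENNReal.ofReal (Ψ (θ * fderiv ℝ g (p ω) (p' ω))) :=
    (hΨc.measurable.comp ((measurable_fderiv_apply g hp hp').const_mul θ)).ennreal_ofReal
  have hms : MeasurableSet {q : ℝ × Ω | DifferentiableAt ℝ g (p (R q.1 q.2))} :=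
    (hp.comp hRm) (measurableSet_of_differentiableAt ℝ g)
  have hae : ∀ᵐ ω ∂ν, ∀ᵐ s : ℝ ∂(volume.restrict (Set.Ioc 0 θ)),
      DifferentiableAt ℝ g (p (R s ω)) := by
    refine (Measure.ae_ae_comm
      (p := fun (s : ℝ) (ω : Ω) ↦ DifferentiableAt ℝ g (p (R s ω))) hms).1 ?_
    exact Filter.Eventually.of_forall fun s ↦ (hR s).quasiMeasurePreserving.ae hdiff
  calc ∫⁻ ω, ENNReal.ofReal (Ψ (g (p (R θ ω)) - g (p (R 0 ω)))) ∂ν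
      ≤ ∫⁻ ω, ((ENNReal.ofReal θ)⁻¹ * ∫⁻ s in Set.Ioc 0 θ,
          ENNReal.ofReal (Ψ (θ * fderiv ℝ g (p (R s ω)) (p' (R s ω))))) ∂ν :=
        lintegral_mono_ae <| hae.mono fun ω hω ↦
          ofReal_convex_increment_le hg (hc ω) (hc' ω) hΨ hΨ0 hθ hω
    _ = (ENNReal.ofReal θ)⁻¹ * ∫⁻ s in Set.Ioc 0 θ, ∫⁻ ω,
          ENNReal.ofReal (Ψ (θ * fderiv ℝ g (p (R s ω)) (p' (R s ω)))) ∂ν := by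
        rw [lintegral_const_mul']
        · congr 1
          exact (lintegral_lintegral_swap (f := fun s ω ↦
            ENNReal.ofReal (Ψ (θ * fderiv ℝ g (p (R s ω)) (p' (R s ω)))))
            (hFm.comp hRm).aemeasurable).symm
        · simp [hθ]
    _ = (ENNReal.ofReal θ)⁻¹ * ∫⁻ s in Set.Ioc 0 θ, ∫⁻ ω,
          ENNReal.ofReal (Ψ (θ * fderiv ℝ g (p ω) (p' ω))) ∂ν := by
        congr 1
        exact lintegral_congr fun s ↦ (hR s).lintegral_comp hFm
    _ = ∫⁻ ω, ENNReal.ofReal (Ψ (θ * fderiv ℝ g (p ω) (p' ω))) ∂ν := by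
        rw [lintegral_const, Measure.restrict_apply_univ, Real.volume_Ioc, sub_zero, mul_comm,
          mul_assoc, ENNReal.mul_inv_cancel (by simp [hθ]) (by simp), mul_one]

lemma ae_differentiableAt_stdGaussian {n : ℕ} {g : (Fin n → ℝ) → ℝ} {K : NNReal}
    (hg : LipschitzWith K g) : ∀ᵐ x ∂(_root_.stdGaussian n), DifferentiableAt ℝ g x :=
  (stdGaussian_absolutelyContinuous n).ae_le hg.ae_differentiableAt

/-- The case of rotations in `ℝⁿ × ℝⁿ`. -/
lemma lintegral_convex_rotation_le {n : ℕ} {g : (Fin n → ℝ) → ℝ} {K : NNReal}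
    (hg : LipschitzWith K g) {Ψ : ℝ → ℝ} (hΨ : ConvexOn ℝ Set.univ Ψ) (hΨ0 : ∀ x, 0 ≤ Ψ x)
    {θ : ℝ} (hθ : 0 < θ) :
    ∫⁻ q, ENNReal.ofReal (Ψ (g (cos θ • q.1 + sin θ • q.2) - g q.1))
        ∂((_root_.stdGaussian n).prod (_root_.stdGaussian n)) ≤
      ∫⁻ q, ENNReal.ofReal (Ψ (θ * fderiv ℝ g q.1 q.2))
        ∂((_root_.stdGaussian n).prod (_root_.stdGaussian n)) := by
  have h := lintegral_convex_increment_le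
    (ν := (_root_.stdGaussian n).prod (_root_.stdGaussian n))
    (R := fun s q ↦ (cos s • q.1 + sin s • q.2, -sin s • q.1 + cos s • q.2))
    (by unfold Function.uncurry; fun_prop) (measurePreserving_rot_stdGaussian n)
    (p := Prod.fst) (p' := Prod.snd) measurable_fst measurable_snd
    (fun q s ↦ by
      have := ((hasDerivAt_cos s).smul_const q.1).add ((hasDerivAt_sin s).smul_const q.2)
      exact this) (fun q ↦ by fun_prop) hg
    (Measure.quasiMeasurePreserving_fst.ae (ae_differentiableAt_stdGaussian hg)) hΨ hΨ0 hθ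
  simpa using h

/-- The `L¹` Poincaré inequality in one coordinate. -/
lemma lintegral_abs_sub_insertNth_le {n : ℕ} {g : (Fin (n + 1) → ℝ) → ℝ} {K : NNReal}
    (hg : LipschitzWith K g) (i : Fin (n + 1)) :
    ∫⁻ q, ENNReal.ofReal |g (i.insertNth q.1.2 q.2) - g (i.insertNth q.1.1 q.2)|
        ∂(((gaussianReal 0 1).prod (gaussianReal 0 1)).prod (_root_.stdGaussian n)) ≤
      ∫⁻ q, ENNReal.ofReal |π / 2 * (q.1.2 * partialDeriv g i (i.insertNth q.1.1 q.2))|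
        ∂(((gaussianReal 0 1).prod (gaussianReal 0 1)).prod (_root_.stdGaussian n)) := by
  have hfst : MeasurePreserving
      (fun q : (ℝ × ℝ) × (Fin n → ℝ) ↦ (i.insertNth q.1.1 q.2 : Fin (n + 1) → ℝ))
      (((gaussianReal 0 1).prod (gaussianReal 0 1)).prod (_root_.stdGaussian n))
      (_root_.stdGaussian (n + 1)) :=
    (measurePreserving_insertNth i).comp
      (measurePreserving_fst.prod (MeasurePreserving.id _))
  have hsingle : Measurable
      (fun q : (ℝ × ℝ) × (Fin n → ℝ) ↦ (Pi.single i q.1.2 : Fin (n + 1) → ℝ)) :=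
    (measurable_pi_iff.2 fun j ↦ by
      by_cases h : j = i
      · subst h; simpa using by fun_prop
      · simp [h])
  have hins : ∀ (a : ℝ) (x : Fin n → ℝ), (i.insertNth a x : Fin (n + 1) → ℝ)
      = i.insertNth 0 x + a • Pi.single i 1 := by
    intro a x
    ext j
    refine i.succAboveCases ?_ (fun j ↦ ?_) j <;> simp
  have hsmul : ∀ a : ℝ, (Pi.single i a : Fin (n + 1) → ℝ) = a • Pi.single i 1 := by
    intro a; simp [← Pi.single_smul]
  have h := lintegral_convex_increment_le
    (ν := ((gaussianReal 0 1).prod (gaussianReal 0 1)).prod (_root_.stdGaussian n))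
    (R := fun s q ↦ ((cos s • q.1.1 + sin s • q.1.2, -sin s • q.1.1 + cos s • q.1.2), q.2))
    (by unfold Function.uncurry; fun_prop)
    (fun s ↦ (measurePreserving_rot_gaussianReal s).prod (MeasurePreserving.id _))
    (p := fun q ↦ i.insertNth q.1.1 q.2) (p' := fun q ↦ Pi.single i q.1.2)
    hfst.measurable hsingle
    (fun q s ↦ by
      have := (((hasDerivAt_cos s).smul_const q.1.1).add
        ((hasDerivAt_sin s).smul_const q.1.2)).smul_const (Pi.single i 1 : Fin (n + 1) → ℝ)
      have h2 := this.const_add (i.insertNth 0 q.2 : Fin (n + 1) → ℝ)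
      rw [← hsmul] at h2
      exact h2.congr_of_eventuallyEq (Filter.Eventually.of_forall fun t ↦ hins _ _))
    (fun q ↦ (continuous_single i).comp (by fun_prop)) hg
    (hfst.quasiMeasurePreserving.ae (ae_differentiableAt_stdGaussian hg))
    (Ψ := fun x ↦ |x|) (convexOn_norm convex_univ) (fun x ↦ abs_nonneg x) (θ := π / 2)
    (by positivity)
  have hpd : ∀ x a, fderiv ℝ g x (Pi.single i a) = a * partialDeriv g i x := by
    intro x a
    rw [hsmul, map_smul, smul_eq_mul, partialDeriv]
  simpa [hpd] using h

/-- The Mehler kernel of the Ornstein–Uhlenbeck operator with correlation `ρ`. -/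
noncomputable def mehlerKernel (ρ x z : ℝ) : ℝ :=
  (√(1 - ρ ^ 2))⁻¹ * exp (-(ρ ^ 2 * z ^ 2 - 2 * ρ * x * z + ρ ^ 2 * x ^ 2) / (2 * (1 - ρ ^ 2)))

lemma measurable_mehlerKernel (ρ : ℝ) :
    Measurable fun q : ℝ × ℝ ↦ mehlerKernel ρ q.1 q.2 := by
  unfold mehlerKernel; fun_prop

lemma integral_comp_eq_mehlerKernel {ρ : ℝ} (h1 : ρ ^ 2 < 1) {v : ℝ → ℝ} (hv : Measurable v)
    (x : ℝ) :
    ∫ y, v (ρ * x + √(1 - ρ ^ 2) * y) ∂gaussianReal 0 1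
      = ∫ z, v z * mehlerKernel ρ x z ∂gaussianReal 0 1 := by
  have hs : 0 < 1 - ρ ^ 2 := by linarith
  have hvar : (1 - ρ ^ 2).toNNReal ≠ 0 := (Real.toNNReal_pos.2 hs).ne'
  have hmap : (gaussianReal 0 1).map (fun y ↦ ρ * x + √(1 - ρ ^ 2) * y)
      = gaussianReal (ρ * x) (1 - ρ ^ 2).toNNReal := by
    have h2 := gaussianReal_map_const_add (μ := 0) (v := (1 - ρ ^ 2).toNNReal) (ρ * x)
    have h3 := gaussianReal_map_const_mul (μ := 0) (v := 1) (√(1 - ρ ^ 2))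
    have h4 : NNReal.mk (√(1 - ρ ^ 2) ^ 2) (sq_nonneg _) * 1 = (1 - ρ ^ 2).toNNReal := by
      rw [mul_one]
      refine NNReal.eq ?_
      rw [Real.coe_toNNReal _ hs.le]
      exact Real.sq_sqrt hs.le
    rw [h4, mul_zero] at h3
    rw [← h3, Measure.map_map (by fun_prop) (by fun_prop), zero_add] at h2
    exact h2
  rw [← integral_map (φ := fun y ↦ ρ * x + √(1 - ρ ^ 2) * y) (f := v) (by fun_prop)
    hv.aestronglyMeasurable, hmap, integral_gaussianReal_eq_integral_smul hvar,
    integral_gaussianReal_eq_integral_smul one_ne_zero]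
  congr 1
  funext z
  simp only [gaussianPDFReal, mehlerKernel, smul_eq_mul, NNReal.coe_one,
    Real.coe_toNNReal _ hs.le]
  have hexp : exp (-(z - ρ * x) ^ 2 / (2 * (1 - ρ ^ 2))) = exp (-(z - 0) ^ 2 / (2 * 1)) *
      exp (-(ρ ^ 2 * z ^ 2 - 2 * ρ * x * z + ρ ^ 2 * x ^ 2) / (2 * (1 - ρ ^ 2))) := by
    rw [← Real.exp_add]
    congr 1
    field_simp
    ring
  rw [hexp, Real.sqrt_mul (by positivity) (1 - ρ ^ 2), mul_one, mul_inv]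
  ring_nf

lemma abs_mehlerKernel_sub_one_le {ρ : ℝ} (h0 : 0 ≤ ρ) (h1 : ρ ≤ 1 / 16) (x z : ℝ) :
    |mehlerKernel ρ x z - 1| ≤ 2 * exp ((x ^ 2 + z ^ 2) / 16) := by
  have hs : 1 / 2 ≤ 1 - ρ ^ 2 := by nlinarith
  have hsq : (√(1 - ρ ^ 2))⁻¹ ≤ 2 := by
    rw [inv_le_comm₀ (by positivity) (by norm_num)]
    exact Real.le_sqrt_of_sq_le (by norm_num; linarith)
  have hexp : -(ρ ^ 2 * z ^ 2 - 2 * ρ * x * z + ρ ^ 2 * x ^ 2) / (2 * (1 - ρ ^ 2))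
      ≤ (x ^ 2 + z ^ 2) / 16 := by
    rw [div_le_iff₀ (by linarith)]
    have h2 : 2 * ρ * x * z ≤ ρ * (x ^ 2 + z ^ 2) := by nlinarith [sq_nonneg (x - z)]
    have h3 : ρ * (x ^ 2 + z ^ 2) ≤ 1 / 16 * (x ^ 2 + z ^ 2) := by gcongr
    have h4 : 1 / 16 * (x ^ 2 + z ^ 2) ≤ (x ^ 2 + z ^ 2) / 16 * (2 * (1 - ρ ^ 2)) := by
      nlinarith [sq_nonneg x, sq_nonneg z]
    nlinarith [sq_nonneg (ρ * z), sq_nonneg (ρ * x)]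
  have hM : mehlerKernel ρ x z ≤ 2 * exp ((x ^ 2 + z ^ 2) / 16) :=
    mul_le_mul hsq (Real.exp_le_exp.2 hexp) (by positivity) (by norm_num)
  have hM0 : 0 ≤ mehlerKernel ρ x z := by unfold mehlerKernel; positivity
  have hE : 1 ≤ exp ((x ^ 2 + z ^ 2) / 16) := Real.one_le_exp (by positivity)
  rw [abs_le]
  constructor <;> linarith

lemma lintegral_exp_sq_div_four_lt_top :
    ∫⁻ x, ENNReal.ofReal (exp (x ^ 2 / 4)) ∂gaussianReal 0 1 < ⊤ := by
  rw [gaussianReal_of_var_ne_zero 0 one_ne_zero, lintegral_withDensity_eq_lintegral_mul _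
    (measurable_gaussianPDF 0 1) (by fun_prop)]
  have h := ((integrable_exp_neg_mul_sq (b := 1 / 4) (by norm_num)).const_mul
    (√(2 * π))⁻¹).lintegral_lt_top
  refine lt_of_le_of_lt (le_of_eq (lintegral_congr fun x ↦ ?_)) h
  rw [Pi.mul_apply, gaussianPDF, ← ENNReal.ofReal_mul (gaussianPDFReal_nonneg _ _ _),
    gaussianPDFReal, mul_assoc, ← Real.exp_add]
  congr 2
  · simp
  · congr 1
    norm_num
    ring_nf

open Filter Topology in
lemma exists_lintegral_mehlerKernel_sub_one_le :
    ∃ ρ : ℝ, 0 < ρ ∧ ρ < 1 ∧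
      ∫⁻ x, ∫⁻ z, ENNReal.ofReal ((mehlerKernel ρ x z - 1) ^ 4) ∂gaussianReal 0 1
        ∂gaussianReal 0 1 ≤ ENNReal.ofReal (1 / 16) := by
  set γ := gaussianReal 0 1
  let r : ℕ → ℝ := fun k ↦ 1 / ((k : ℝ) + 16)
  have hr0 : ∀ k, 0 < r k := fun k ↦ by positivity
  have hr1 : ∀ k, r k ≤ 1 / 16 := fun k ↦
    one_div_le_one_div_of_le (by norm_num) (by linarith [Nat.cast_nonneg (α := ℝ) k])
  have hrt : Tendsto r atTop (𝓝 0) := by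
    have := (tendsto_natCast_atTop_atTop (R := ℝ)).atTop_add (tendsto_const_nhds (x := (16 : ℝ)))
    exact this.inv_tendsto_atTop.congr fun k ↦ (one_div _).symm
  have hlim : Tendsto (fun k ↦ ∫⁻ q, ENNReal.ofReal ((mehlerKernel (r k) q.1 q.2 - 1) ^ 4)
      ∂(γ.prod γ)) atTop (𝓝 (∫⁻ _, 0 ∂(γ.prod γ))) := by
    refine tendsto_lintegral_of_dominated_convergence
      (fun q ↦ ENNReal.ofReal 16 * (ENNReal.ofReal (exp (q.1 ^ 2 / 4)) *
        ENNReal.ofReal (exp (q.2 ^ 2 / 4)))) (fun k ↦ ?_) (fun k ↦ ?_) ?_ ?_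
    · exact (((measurable_mehlerKernel (r k)).sub_const 1).pow_const 4).ennreal_ofReal
    · refine Eventually.of_forall fun q ↦ ?_
      beta_reduce
      rw [← ENNReal.ofReal_mul (by positivity), ← ENNReal.ofReal_mul (by norm_num)]
      refine ENNReal.ofReal_le_ofReal ?_
      have := pow_le_pow_left₀ (abs_nonneg _)
        (abs_mehlerKernel_sub_one_le (hr0 k).le (hr1 k) q.1 q.2) 4
      rw [(by decide : Even 4).pow_abs, mul_pow, ← Real.exp_nat_mul] at this
      refine this.trans_eq ?_
      rw [← Real.exp_add]
      norm_num
      ring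
    · rw [lintegral_const_mul _ (by fun_prop), 
        lintegral_prod_mul (f := fun x : ℝ ↦ ENNReal.ofReal (exp (x ^ 2 / 4)))
          (g := fun x : ℝ ↦ ENNReal.ofReal (exp (x ^ 2 / 4))) (by fun_prop) (by fun_prop)]
      exact ENNReal.mul_ne_top (by simp) (ENNReal.mul_ne_top
        lintegral_exp_sq_div_four_lt_top.ne lintegral_exp_sq_div_four_lt_top.ne)
    · refine Eventually.of_forall fun q ↦ ?_
      have hc : ContinuousAt (fun ρ ↦ (mehlerKernel ρ q.1 q.2 - 1) ^ 4) 0 := by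
        unfold mehlerKernel
        have : √(1 - (0 : ℝ) ^ 2) ≠ 0 := by simp
        have : 2 * (1 - (0 : ℝ) ^ 2) ≠ 0 := by simp
        fun_prop (disch := assumption)
      have := ENNReal.tendsto_ofReal (hc.tendsto.comp hrt)
      simpa [mehlerKernel] using this
  rw [lintegral_zero] at hlim
  obtain ⟨k, hk⟩ := (hlim.eventually_le_const
    (show (0 : ENNReal) < ENNReal.ofReal (1 / 16) by simp)).exists
  refine ⟨r k, hr0 k, (hr1 k).trans_lt (by norm_num), ?_⟩
  rwa [lintegral_prod _
    (((measurable_mehlerKernel (r k)).sub_const 1).pow_const 4).ennreal_ofReal.aemeasurable] at hk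

lemma sq_lintegral_mul_le {Ω : Type*} [MeasurableSpace Ω] (μ : Measure Ω) {f g : Ω → ENNReal}
    (hf : AEMeasurable f μ) (hg : AEMeasurable g μ) :
    (∫⁻ ω, f ω * g ω ∂μ) ^ 2 ≤ (∫⁻ ω, f ω ^ 2 ∂μ) * ∫⁻ ω, g ω ^ 2 ∂μ := by
  have h := ENNReal.lintegral_mul_le_Lp_mul_Lq μ (Real.HolderConjugate.two_two) hf hg
  simp only [Pi.mul_apply, ENNReal.rpow_two] at h
  refine (pow_le_pow_left' h 2).trans_eq ?_
  rw [mul_pow, ← ENNReal.rpow_natCast, ← ENNReal.rpow_natCast, ← ENNReal.rpow_mul,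
    ← ENNReal.rpow_mul]
  norm_num

lemma sq_lintegral_le {Ω : Type*} [MeasurableSpace Ω] (μ : Measure Ω) [IsProbabilityMeasure μ]
    {f : Ω → ENNReal} (hf : AEMeasurable f μ) :
    (∫⁻ ω, f ω ∂μ) ^ 2 ≤ ∫⁻ ω, f ω ^ 2 ∂μ := by
  simpa using sq_lintegral_mul_le μ hf (aemeasurable_const (b := 1))

lemma pow_four_lintegral_mul_le {Ω : Type*} [MeasurableSpace Ω] (μ : Measure Ω)
    [IsProbabilityMeasure μ] {f g : Ω → ENNReal}
    (hf : AEMeasurable f μ) (hg : AEMeasurable g μ) :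
    (∫⁻ ω, f ω * g ω ∂μ) ^ 4 ≤ (∫⁻ ω, f ω ^ 2 ∂μ) ^ 2 * ∫⁻ ω, g ω ^ 4 ∂μ := by
  calc (∫⁻ ω, f ω * g ω ∂μ) ^ 4 = ((∫⁻ ω, f ω * g ω ∂μ) ^ 2) ^ 2 := by rw [← pow_mul]
    _ ≤ ((∫⁻ ω, f ω ^ 2 ∂μ) * ∫⁻ ω, g ω ^ 2 ∂μ) ^ 2 :=
        pow_le_pow_left' (sq_lintegral_mul_le μ hf hg) 2
    _ = (∫⁻ ω, f ω ^ 2 ∂μ) ^ 2 * (∫⁻ ω, g ω ^ 2 ∂μ) ^ 2 := mul_pow _ _ _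
    _ ≤ (∫⁻ ω, f ω ^ 2 ∂μ) ^ 2 * ∫⁻ ω, (g ω ^ 2) ^ 2 ∂μ := by
        gcongr
        exact sq_lintegral_le μ (hg.pow_const 2)
    _ = _ := by simp only [← pow_mul, Nat.reduceMul]

lemma integrable_of_bound {Ω : Type*} [MeasurableSpace Ω] {μ : Measure Ω} [IsFiniteMeasure μ]
    {f : Ω → ℝ} (hf : Measurable f) {C : ℝ} (hC : ∀ ω, |f ω| ≤ C) : Integrable f μ :=
  .of_bound hf.aestronglyMeasurable C (Filter.Eventually.of_forall hC)

lemma measurable_mehlerKernel_right (ρ x : ℝ) : Measurable (mehlerKernel ρ x) := by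
  unfold mehlerKernel; fun_prop

lemma integral_mehlerKernel {ρ : ℝ} (h1 : ρ ^ 2 < 1) (x : ℝ) :
    ∫ z, mehlerKernel ρ x z ∂gaussianReal 0 1 = 1 := by
  simpa using (integral_comp_eq_mehlerKernel h1 (v := fun _ ↦ 1) measurable_const x).symm

lemma integrable_mehlerKernel {ρ : ℝ} (h1 : ρ ^ 2 < 1) (x : ℝ) :
    Integrable (mehlerKernel ρ x) (gaussianReal 0 1) := by
  by_contra h
  have := integral_mehlerKernel h1 x
  rw [integral_undef h] at this
  norm_num at this

lemma integral_comp_arccos {ρ : ℝ} (h0 : 0 ≤ ρ) (h1 : ρ ≤ 1) {v : ℝ → ℝ} (hv : Measurable v)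
    {C : ℝ} (hC : ∀ x, |v x| ≤ C) :
    ∫ x, ∫ y, v (ρ * x + √(1 - ρ ^ 2) * y) ∂gaussianReal 0 1 ∂gaussianReal 0 1
      = ∫ x, v x ∂gaussianReal 0 1 := by
  have hm : Measurable fun q : ℝ × ℝ ↦ v (ρ * q.1 + √(1 - ρ ^ 2) * q.2) :=
    hv.comp (by fun_prop)
  rw [← integral_prod (f := fun q : ℝ × ℝ ↦ v (ρ * q.1 + √(1 - ρ ^ 2) * q.2))
    (integrable_of_bound hm fun _ ↦ hC _)]
  have hp := measurePreserving_fst.comp (measurePreserving_rot_gaussianReal (arccos ρ))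
  have h2 := integral_map (μ := (gaussianReal 0 1).prod (gaussianReal 0 1)) (f := v)
    hp.measurable.aemeasurable hv.aestronglyMeasurable
  rw [hp.map_eq] at h2
  rw [h2]
  simp [Real.cos_arccos (by linarith : -1 ≤ ρ) h1, Real.sin_arccos]

lemma integrable_pow_of_bound {Ω : Type*} [MeasurableSpace Ω] {μ : Measure Ω}
    [IsFiniteMeasure μ] {u : Ω → ℝ} {D : ℝ} (k : ℕ) (hu : Measurable u) (hD : ∀ x, |u x| ≤ D) :
    Integrable (fun x ↦ u x ^ k) μ :=
  integrable_of_bound (hu.pow_const k) fun x ↦ by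
    rw [abs_pow]; exact pow_le_pow_left₀ (abs_nonneg _) (hD x) k

lemma abs_integral_le_of_bound {Ω : Type*} [MeasurableSpace Ω] (μ : Measure Ω)
    [IsProbabilityMeasure μ] {f : Ω → ℝ} {C : ℝ} (hC : ∀ ω, |f ω| ≤ C) : |∫ ω, f ω ∂μ| ≤ C := by
  simpa using norm_integral_le_of_norm_le_const (μ := μ) (f := f) (Filter.Eventually.of_forall hC)

lemma integral_pow_four_add_le {Ω : Type*} [MeasurableSpace Ω] {μ : Measure Ω}
    [IsProbabilityMeasure μ] {h : Ω → ℝ} (hhm : Measurable h) {D m W : ℝ}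
    (hhC : ∀ ω, |h ω| ≤ D) (hh0 : ∫ ω, h ω ∂μ = 0) (hW0 : 0 ≤ W)
    (hh4 : ∫ ω, h ω ^ 4 ∂μ ≤ W ^ 2 / 16) :
    ∫ ω, (m + h ω) ^ 4 ∂μ ≤ (m ^ 2 + W) ^ 2 := by
  have hh2 : ∫ x, h x ^ 2 ∂μ ≤ W / 4 := by
    have h8 := variance_nonneg (fun x ↦ h x ^ 2) μ
    rw [variance_eq_sub (memLp_two_iff_integrable_sq
      (hhm.pow_const 2).aestronglyMeasurable |>.2
        (by simpa [← pow_mul] using integrable_pow_of_bound 4 hhm hhC))] at h8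
    simp only [Pi.pow_apply, ← pow_mul, Nat.reduceMul] at h8
    refine le_of_sq_le_sq ?_ (by positivity)
    linarith
  have hle : ∀ x, (m + h x) ^ 4 ≤ m ^ 4 + 4 * m ^ 3 * h x + 8 * m ^ 2 * h x ^ 2 + 3 * h x ^ 4 := by
    intro x
    nlinarith [mul_nonneg (sq_nonneg (h x)) (sq_nonneg (m - h x))]
  have hi1 := (integrable_of_bound (μ := μ) hhm hhC).const_mul (4 * m ^ 3)
  have hi2 := (integrable_pow_of_bound (μ := μ) 2 hhm hhC).const_mul (8 * m ^ 2)
  have hi4 := (integrable_pow_of_bound (μ := μ) 4 hhm hhC).const_mul 3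
  have hi := integrable_const (μ := μ) (m ^ 4)
  have h9 : ∫ x, (m + h x) ^ 4 ∂μ ≤
      ∫ x, (m ^ 4 + 4 * m ^ 3 * h x + 8 * m ^ 2 * h x ^ 2 + 3 * h x ^ 4) ∂μ :=
    integral_mono (integrable_pow_of_bound (D := |m| + D) 4 (hhm.const_add m)
      fun x ↦ (abs_add_le _ _).trans (by linarith [hhC x])) (((hi.add hi1).add hi2).add hi4) hle
  rw [integral_add (by exact (hi.add hi1).add hi2) hi4, integral_add (by exact hi.add hi1) hi2,
    integral_add hi hi1, integral_const_mul, integral_const_mul, integral_const_mul, hh0] at h9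
  simp only [integral_const, probReal_univ, one_smul] at h9
  nlinarith [mul_le_mul_of_nonneg_left hh2 (sq_nonneg m), sq_nonneg W]

lemma integral_sq_eq_sq_add {Ω : Type*} [MeasurableSpace Ω] {μ : Measure Ω}
    [IsProbabilityMeasure μ] {v : Ω → ℝ} (hv : Measurable v) {C : ℝ} (hC : ∀ ω, |v ω| ≤ C) :
    ∫ ω, v ω ^ 2 ∂μ = (∫ ω, v ω ∂μ) ^ 2 + ∫ ω, (v ω - ∫ ω', v ω' ∂μ) ^ 2 ∂μ := by
  have h := variance_eq_sub (memLp_two_iff_integrable_sq hv.aestronglyMeasurable |>.2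
    (integrable_pow_of_bound (μ := μ) 2 hv hC))
  rw [variance_eq_integral hv.aemeasurable] at h
  simp only [Pi.pow_apply] at h
  linarith

lemma integral_pow_four_centered_le {ρ : ℝ} (hρ2 : ρ ^ 2 < 1)
    (hρ : ∫⁻ x, ∫⁻ z, ENNReal.ofReal ((mehlerKernel ρ x z - 1) ^ 4) ∂gaussianReal 0 1
        ∂gaussianReal 0 1 ≤ ENNReal.ofReal (1 / 16))
    {w : ℝ → ℝ} (hwm : Measurable w) {C : ℝ} (hwC : ∀ x, |w x| ≤ C)
    (hw0 : ∫ x, w x ∂gaussianReal 0 1 = 0) :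
    ∫ x, (∫ y, w (ρ * x + √(1 - ρ ^ 2) * y) ∂gaussianReal 0 1) ^ 4 ∂gaussianReal 0 1
      ≤ (∫ x, w x ^ 2 ∂gaussianReal 0 1) ^ 2 / 16 := by
  have hW0 : 0 ≤ ∫ x, w x ^ 2 ∂gaussianReal 0 1 := integral_nonneg fun _ ↦ sq_nonneg _
  have hpt : ∀ x, ENNReal.ofReal
      ((∫ y, w (ρ * x + √(1 - ρ ^ 2) * y) ∂gaussianReal 0 1) ^ 4) ≤
      ENNReal.ofReal ((∫ x, w x ^ 2 ∂gaussianReal 0 1) ^ 2) *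
        ∫⁻ z, ENNReal.ofReal ((mehlerKernel ρ x z - 1) ^ 4) ∂gaussianReal 0 1 := by
    intro x
    have hMm := measurable_mehlerKernel_right ρ x
    have hwMi : Integrable (fun z ↦ w z * mehlerKernel ρ x z) (gaussianReal 0 1) :=
      (integrable_mehlerKernel hρ2 x).bdd_mul (c := C) hwm.aestronglyMeasurable
        (Filter.Eventually.of_forall fun z ↦ hwC z)
    have heq : ∫ y, w (ρ * x + √(1 - ρ ^ 2) * y) ∂gaussianReal 0 1
        = ∫ z, w z * (mehlerKernel ρ x z - 1) ∂gaussianReal 0 1 := by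
      simp_rw [mul_sub, mul_one]
      rw [integral_sub hwMi (integrable_of_bound hwm hwC), hw0, sub_zero]
      exact integral_comp_eq_mehlerKernel hρ2 hwm x
    have h5 := enorm_integral_le_lintegral_enorm (μ := gaussianReal 0 1)
      (fun z ↦ w z * (mehlerKernel ρ x z - 1))
    rw [← heq] at h5
    simp only [Real.enorm_eq_ofReal_abs, abs_mul, ENNReal.ofReal_mul (abs_nonneg _)] at h5
    have h6 := (pow_le_pow_left' h5 4).trans (pow_four_lintegral_mul_le _ (by fun_prop)
      (by fun_prop))
    simp only [← ENNReal.ofReal_pow (abs_nonneg _), sq_abs,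
      (by decide : Even 4).pow_abs] at h6
    rwa [← ofReal_integral_eq_lintegral_ofReal (integrable_pow_of_bound 2 hwm hwC)
      (Filter.Eventually.of_forall fun _ ↦ sq_nonneg _), ← ENNReal.ofReal_pow hW0] at h6
  have h7 := lintegral_mono hpt (μ := gaussianReal 0 1)
  rw [lintegral_const_mul' _ _ (by simp)] at h7
  replace h7 := h7.trans (mul_le_mul_right hρ _)
  have hm : Measurable fun x ↦ ∫ y, w (ρ * x + √(1 - ρ ^ 2) * y) ∂gaussianReal 0 1 := by
    have : StronglyMeasurable fun q : ℝ × ℝ ↦ w (ρ * q.1 + √(1 - ρ ^ 2) * q.2) :=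
      (hwm.comp (by fun_prop)).stronglyMeasurable
    exact this.integral_prod_right.measurable
  rw [← ENNReal.ofReal_mul (by positivity), ← ofReal_integral_eq_lintegral_ofReal
    (integrable_pow_of_bound 4 hm fun x ↦ abs_integral_le_of_bound _ fun y ↦ hwC _)
    (Filter.Eventually.of_forall fun _ ↦ by positivity),
    ENNReal.ofReal_le_ofReal_iff (by positivity)] at h7
  linarith

/-- Hypercontractivity from `L²` to `L⁴` on the line, for bounded functions. -/
lemma integral_pow_four_le_of_bounded {ρ : ℝ} (h0 : 0 < ρ) (h1 : ρ < 1)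
    (hρ : ∫⁻ x, ∫⁻ z, ENNReal.ofReal ((mehlerKernel ρ x z - 1) ^ 4) ∂gaussianReal 0 1
        ∂gaussianReal 0 1 ≤ ENNReal.ofReal (1 / 16))
    {v : ℝ → ℝ} (hv : Measurable v) {C : ℝ} (hC : ∀ x, |v x| ≤ C) :
    ∫ x, (∫ y, v (ρ * x + √(1 - ρ ^ 2) * y) ∂gaussianReal 0 1) ^ 4 ∂gaussianReal 0 1
      ≤ (∫ x, v x ^ 2 ∂gaussianReal 0 1) ^ 2 := by
  have hρ2 : ρ ^ 2 < 1 := by nlinarith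
  obtain ⟨m, hm⟩ : ∃ m, ∫ x, v x ∂gaussianReal 0 1 = m := ⟨_, rfl⟩
  have hwm : Measurable fun z ↦ v z - m := hv.sub_const m
  have hwC : ∀ x, |v x - m| ≤ C + |m| := fun x ↦ by
    have := abs_sub (v x) m
    linarith [hC x]
  have hw0 : ∫ x, (v x - m) ∂gaussianReal 0 1 = 0 := by
    rw [integral_sub (integrable_of_bound hv hC) (integrable_const _), hm]; simp
  have hmh : ∀ x, ∫ y, v (ρ * x + √(1 - ρ ^ 2) * y) ∂gaussianReal 0 1
      = m + ∫ y, (v (ρ * x + √(1 - ρ ^ 2) * y) - m) ∂gaussianReal 0 1 := by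
    intro x
    have hvx : Measurable fun y ↦ v (ρ * x + √(1 - ρ ^ 2) * y) := hv.comp (by fun_prop)
    rw [integral_sub (integrable_of_bound hvx fun _ ↦ hC _) (integrable_const _)]
    simp
  have hhm : Measurable fun x ↦ ∫ y, (v (ρ * x + √(1 - ρ ^ 2) * y) - m) ∂gaussianReal 0 1 := by
    have : StronglyMeasurable fun q : ℝ × ℝ ↦ v (ρ * q.1 + √(1 - ρ ^ 2) * q.2) - m :=
      (hwm.comp (by fun_prop : Measurable fun q : ℝ × ℝ ↦
        ρ * q.1 + √(1 - ρ ^ 2) * q.2)).stronglyMeasurable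
    exact this.integral_prod_right.measurable
  simp_rw [hmh]
  rw [integral_sq_eq_sq_add hv hC, hm]
  exact integral_pow_four_add_le hhm (fun x ↦ abs_integral_le_of_bound _ fun y ↦ hwC _)
    ((integral_comp_arccos h0.le h1.le hwm hwC).trans hw0)
    (integral_nonneg fun _ ↦ sq_nonneg _) (integral_pow_four_centered_le hρ2 hρ hwm hwC hw0)

open Filter Topology in
/-- Hypercontractivity from `L²` to `L⁴` on the line. -/
lemma exists_lintegral_pow_four_le :
    ∃ ρ : ℝ, 0 < ρ ∧ ρ < 1 ∧ ∀ v : ℝ → ENNReal, Measurable v →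
      ∫⁻ x, (∫⁻ y, v (ρ * x + √(1 - ρ ^ 2) * y) ∂gaussianReal 0 1) ^ 4 ∂gaussianReal 0 1
        ≤ (∫⁻ x, v x ^ 2 ∂gaussianReal 0 1) ^ 2 := by
  obtain ⟨ρ, h0, h1, hρ⟩ := exists_lintegral_mehlerKernel_sub_one_le
  refine ⟨ρ, h0, h1, fun v hv ↦ ?_⟩
  have hbdd : ∀ N : ℕ,
      ∫⁻ x, (∫⁻ y, min (v (ρ * x + √(1 - ρ ^ 2) * y)) N ∂gaussianReal 0 1) ^ 4 ∂gaussianReal 0 1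
        ≤ (∫⁻ x, v x ^ 2 ∂gaussianReal 0 1) ^ 2 := by
    intro N
    set u : ℝ → ℝ := fun x ↦ (min (v x) N).toReal with hu
    have hum : Measurable u := (hv.min measurable_const).ennreal_toReal
    have hu0 : ∀ x, 0 ≤ u x := fun x ↦ ENNReal.toReal_nonneg
    have huN : ∀ x, |u x| ≤ N := fun x ↦ by
      rw [abs_of_nonneg (hu0 x)]
      exact ENNReal.toReal_le_of_le_ofReal (by positivity) (by simp)
    have huv : ∀ x, min (v x) N = ENNReal.ofReal (u x) := fun x ↦
      (ENNReal.ofReal_toReal (by simp)).symm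
    have h := ENNReal.ofReal_le_ofReal (integral_pow_four_le_of_bounded h0 h1 hρ hum huN)
    have hmeas : Measurable fun x ↦ ∫ y, u (ρ * x + √(1 - ρ ^ 2) * y) ∂gaussianReal 0 1 := by
      have : StronglyMeasurable fun q : ℝ × ℝ ↦ u (ρ * q.1 + √(1 - ρ ^ 2) * q.2) :=
        (hum.comp (by fun_prop)).stronglyMeasurable
      exact this.integral_prod_right.measurable
    rw [ofReal_integral_eq_lintegral_ofReal
      (integrable_pow_of_bound 4 hmeas fun x ↦ abs_integral_le_of_bound _ fun y ↦ huN _)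
      (Eventually.of_forall fun _ ↦ by positivity),
      ENNReal.ofReal_pow (integral_nonneg fun _ ↦ sq_nonneg _),
      ofReal_integral_eq_lintegral_ofReal (integrable_pow_of_bound 2 hum huN)
      (Eventually.of_forall fun _ ↦ sq_nonneg _)] at h
    simp_rw [ENNReal.ofReal_pow (hu0 _), ENNReal.ofReal_pow (integral_nonneg fun y ↦ hu0 _)] at h
    calc _ = ∫⁻ x, ENNReal.ofReal (∫ y, u (ρ * x + √(1 - ρ ^ 2) * y) ∂gaussianReal 0 1) ^ 4
          ∂gaussianReal 0 1 := by
          refine lintegral_congr fun x ↦ ?_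
          have hux : Measurable fun y ↦ u (ρ * x + √(1 - ρ ^ 2) * y) := hum.comp (by fun_prop)
          rw [ofReal_integral_eq_lintegral_ofReal (integrable_of_bound hux fun _ ↦ huN _)
            (Eventually.of_forall fun _ ↦ hu0 _)]
          simp_rw [huv]
      _ ≤ _ := h
      _ ≤ _ := by
          gcongr with x
          rw [← huv]
          exact min_le_left _ _
  have hv2 : Measurable fun q : ℝ × ℝ ↦ v (ρ * q.1 + √(1 - ρ ^ 2) * q.2) :=
    hv.comp (by fun_prop)
  have hmono : ∀ t : ENNReal, Monotone fun N : ℕ ↦ min t (N : ENNReal) := fun t i j hij ↦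
    min_le_min_left _ (by exact_mod_cast hij)
  have hmin : ∀ t : ENNReal, Tendsto (fun N : ℕ ↦ min t (N : ENNReal)) atTop (𝓝 t) := fun t ↦ by
    simpa using tendsto_const_nhds.min ENNReal.tendsto_nat_nhds_top
  refine le_of_tendsto' (lintegral_tendsto_of_tendsto_of_monotone (fun N ↦ ?_) ?_ ?_) hbdd
  · exact ((hv2.min measurable_const).lintegral_prod_right'.pow_const 4).aemeasurable
  · exact Eventually.of_forall fun x i j hij ↦ by
      dsimp only
      gcongr with y
  · refine Eventually.of_forall fun x ↦ ?_
    refine ((ENNReal.continuous_pow 4).tendsto _).comp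
      (lintegral_tendsto_of_tendsto_of_monotone (fun N ↦ ?_) ?_ ?_)
    · exact ((hv.comp (by fun_prop)).min measurable_const).aemeasurable
    · exact Eventually.of_forall fun y ↦ hmono _
    · exact Eventually.of_forall fun y ↦ hmin _

lemma exists_lintegral_mul_le_real :
    ∃ ρ : ℝ, 0 < ρ ∧ ρ < 1 ∧ ∀ u v : ℝ → ENNReal, Measurable u → Measurable v →
      ∫⁻ x, ∫⁻ y, u x * v (ρ * x + √(1 - ρ ^ 2) * y) ∂gaussianReal 0 1 ∂gaussianReal 0 1
        ≤ (∫⁻ x, u x ^ (4 / 3 : ℝ) ∂gaussianReal 0 1) ^ (3 / 4 : ℝ) *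
          (∫⁻ x, v x ^ (2 : ℝ) ∂gaussianReal 0 1) ^ (1 / 2 : ℝ) := by
  obtain ⟨ρ, h0, h1, h⟩ := exists_lintegral_pow_four_le
  refine ⟨ρ, h0, h1, fun u v hu hv ↦ ?_⟩
  have hv2 : Measurable fun q : ℝ × ℝ ↦ v (ρ * q.1 + √(1 - ρ ^ 2) * q.2) :=
    hv.comp (by fun_prop)
  have hvx : ∀ x, Measurable fun y ↦ v (ρ * x + √(1 - ρ ^ 2) * y) := fun x ↦
    hv.comp (by fun_prop)
  have hpq : (4 / 3 : ℝ).HolderConjugate 4 := by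
    rw [Real.holderConjugate_iff]; norm_num
  calc _ = ∫⁻ x, (u * fun x ↦ ∫⁻ y, v (ρ * x + √(1 - ρ ^ 2) * y) ∂gaussianReal 0 1) x
        ∂gaussianReal 0 1 := by
        refine lintegral_congr fun x ↦ ?_
        rw [lintegral_const_mul _ (hvx x), Pi.mul_apply]
    _ ≤ _ := ENNReal.lintegral_mul_le_Lp_mul_Lq _ hpq hu.aemeasurable
        hv2.lintegral_prod_right'.aemeasurable
    _ ≤ _ := by
        have h2 := ENNReal.rpow_le_rpow (h v hv) (by norm_num : (0 : ℝ) ≤ 1 / 4)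
        have h3 : ∀ t : ENNReal, (t ^ 2) ^ (1 / 4 : ℝ) = t ^ (1 / 2 : ℝ) := fun t ↦ by
          rw [← ENNReal.rpow_natCast, ← ENNReal.rpow_mul]; norm_num
        rw [h3] at h2
        have h4 : ∀ t : ENNReal, t ^ (4 : ℝ) = t ^ 4 := fun t ↦ by
          exact_mod_cast ENNReal.rpow_natCast t 4
        simp only [ENNReal.rpow_two, h4]
        rw [one_div_div]
        exact mul_le_mul_right h2 _

/-- Two-function hypercontractivity for the standard Gaussian measure, by tensorisation. -/
lemma exists_lintegral_mul_le :
    ∃ ρ : ℝ, 0 < ρ ∧ ρ < 1 ∧ ∀ (n : ℕ) (u v : (Fin n → ℝ) → ENNReal), Measurable u →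
      Measurable v →
      ∫⁻ x, ∫⁻ y, u x * v (ρ • x + √(1 - ρ ^ 2) • y) ∂_root_.stdGaussian n ∂_root_.stdGaussian n
        ≤ (∫⁻ x, u x ^ (4 / 3 : ℝ) ∂_root_.stdGaussian n) ^ (3 / 4 : ℝ) *
          (∫⁻ x, v x ^ (2 : ℝ) ∂_root_.stdGaussian n) ^ (1 / 2 : ℝ) := by
  obtain ⟨ρ, h0, h1, h⟩ := exists_lintegral_mul_le_real
  refine ⟨ρ, h0, h1, fun n ↦ ?_⟩
  induction n with
  | zero =>
    intro u v hu hv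
    rw [_root_.stdGaussian, Measure.pi_of_empty]
    simp only [lintegral_dirac]
    rw [← ENNReal.rpow_mul, ← ENNReal.rpow_mul]
    norm_num
    gcongr
    exact le_of_eq (congrArg v (Subsingleton.elim _ _))
  | succ n ih =>
    intro u v hu hv
    have hcons : ∀ {w : (Fin (n + 1) → ℝ) → ENNReal}, Measurable w →
        ∫⁻ x, w x ∂_root_.stdGaussian (n + 1)
          = ∫⁻ x₀, ∫⁻ x, w (Fin.cons x₀ x) ∂_root_.stdGaussian n ∂gaussianReal 0 1 := by
      intro w hw
      rw [← (measurePreserving_cons n).lintegral_comp hw]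
      exact lintegral_prod _ (hw.comp (measurePreserving_cons n).measurable).aemeasurable
    have hcx : ∀ x₀ : ℝ, Measurable fun x : Fin n → ℝ ↦ (Fin.cons x₀ x : Fin (n + 1) → ℝ) :=
      fun x₀ ↦ (measurePreserving_cons n).measurable.comp measurable_prodMk_left
    have hsec : ∀ {w : (Fin (n + 1) → ℝ) → ENNReal}, Measurable w →
        Measurable fun x₀ ↦ ∫⁻ x, w (Fin.cons x₀ x) ∂_root_.stdGaussian n := fun hw ↦
      (hw.comp (measurePreserving_cons n).measurable).lintegral_prod_right'
    have hlin : ∀ (x₀ y₀ : ℝ) (x y : Fin n → ℝ),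
        ρ • (Fin.cons x₀ x : Fin (n + 1) → ℝ) + √(1 - ρ ^ 2) • (Fin.cons y₀ y : Fin (n + 1) → ℝ)
          = Fin.cons (ρ * x₀ + √(1 - ρ ^ 2) * y₀) (ρ • x + √(1 - ρ ^ 2) • y) := by
      intro x₀ y₀ x y
      ext j
      refine Fin.cases ?_ (fun j ↦ ?_) j <;> simp
    have hmeas2 : Measurable fun q : (Fin (n + 1) → ℝ) × (Fin (n + 1) → ℝ) ↦
        u q.1 * v (ρ • q.1 + √(1 - ρ ^ 2) • q.2) :=
      (hu.comp measurable_fst).mul (hv.comp (by fun_prop))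
    calc _ = ∫⁻ x₀, ∫⁻ x, ∫⁻ y₀, ∫⁻ y, u (Fin.cons x₀ x) *
          v (Fin.cons (ρ * x₀ + √(1 - ρ ^ 2) * y₀) (ρ • x + √(1 - ρ ^ 2) • y))
          ∂_root_.stdGaussian n ∂gaussianReal 0 1 ∂_root_.stdGaussian n ∂gaussianReal 0 1 := by
          rw [hcons hmeas2.lintegral_prod_right']
          refine lintegral_congr fun x₀ ↦ lintegral_congr fun x ↦ ?_
          dsimp only
          rw [hcons (w := fun y ↦ u (Fin.cons x₀ x) *
            v (ρ • (Fin.cons x₀ x : Fin (n + 1) → ℝ) + √(1 - ρ ^ 2) • y))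
            (hmeas2.comp measurable_prodMk_left)]
          simp only [hlin]
      _ = ∫⁻ x₀, ∫⁻ y₀, ∫⁻ x, ∫⁻ y, u (Fin.cons x₀ x) *
          v (Fin.cons (ρ * x₀ + √(1 - ρ ^ 2) * y₀) (ρ • x + √(1 - ρ ^ 2) • y))
          ∂_root_.stdGaussian n ∂_root_.stdGaussian n ∂gaussianReal 0 1 ∂gaussianReal 0 1 := by
          refine lintegral_congr fun x₀ ↦ lintegral_lintegral_swap ?_
          have h3 : Measurable fun q : ((Fin n → ℝ) × ℝ) × (Fin n → ℝ) ↦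
              u (Fin.cons x₀ q.1.1) *
              v (Fin.cons (ρ * x₀ + √(1 - ρ ^ 2) * q.1.2) (ρ • q.1.1 + √(1 - ρ ^ 2) • q.2)) :=
            (hu.comp ((hcx x₀).comp (by fun_prop))).mul (hv.comp
              ((measurePreserving_cons n).measurable.comp (g := fun p : ℝ × (Fin n → ℝ) ↦
                (Fin.cons p.1 p.2 : Fin (n + 1) → ℝ))
                (f := fun q : ((Fin n → ℝ) × ℝ) × (Fin n → ℝ) ↦
                (ρ * x₀ + √(1 - ρ ^ 2) * q.1.2, ρ • q.1.1 + √(1 - ρ ^ 2) • q.2)) (by fun_prop)))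
          exact h3.lintegral_prod_right'.aemeasurable
      _ ≤ ∫⁻ x₀, ∫⁻ y₀,
          (∫⁻ x, u (Fin.cons x₀ x) ^ (4 / 3 : ℝ) ∂_root_.stdGaussian n) ^ (3 / 4 : ℝ) *
          (∫⁻ x, v (Fin.cons (ρ * x₀ + √(1 - ρ ^ 2) * y₀) x) ^ (2 : ℝ)
            ∂_root_.stdGaussian n) ^ (1 / 2 : ℝ) ∂gaussianReal 0 1 ∂gaussianReal 0 1 :=
          lintegral_mono fun x₀ ↦ lintegral_mono fun y₀ ↦
            ih (fun x ↦ u (Fin.cons x₀ x))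
              (fun x ↦ v (Fin.cons (ρ * x₀ + √(1 - ρ ^ 2) * y₀) x))
              (hu.comp (hcx _)) (hv.comp (hcx _))
      _ ≤ _ := h (fun x₀ ↦ (∫⁻ x, u (Fin.cons x₀ x) ^ (4 / 3 : ℝ)
            ∂_root_.stdGaussian n) ^ (3 / 4 : ℝ))
            (fun x₀ ↦ (∫⁻ x, v (Fin.cons x₀ x) ^ (2 : ℝ) ∂_root_.stdGaussian n) ^ (1 / 2 : ℝ))
            ((hsec (hu.pow_const _)).pow_const _) ((hsec (hv.pow_const _)).pow_const _)
      _ = _ := by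
          rw [hcons (hu.pow_const _), hcons (hv.pow_const _)]
          simp_rw [← ENNReal.rpow_mul]
          norm_num

lemma exists_lintegral_mul_self_le :
    ∃ ρ : ℝ, 0 < ρ ∧ ρ < 1 ∧ ∀ (n : ℕ) (u : (Fin n → ℝ) → ENNReal), Measurable u →
      (∫⁻ x, ∫⁻ y, u x * u (ρ • x + √(1 - ρ ^ 2) • y)
        ∂_root_.stdGaussian n ∂_root_.stdGaussian n) ^ 4
        ≤ (∫⁻ x, u x ∂_root_.stdGaussian n) ^ 2 * (∫⁻ x, u x ^ 2 ∂_root_.stdGaussian n) ^ 3 := by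
  obtain ⟨ρ, h0, h1, h⟩ := exists_lintegral_mul_le
  refine ⟨ρ, h0, h1, fun n u hu ↦ ?_⟩
  have hpq : (3 / 2 : ℝ).HolderConjugate 3 := by
    rw [Real.holderConjugate_iff]; norm_num
  have h2 := ENNReal.lintegral_mul_le_Lp_mul_Lq (_root_.stdGaussian n) hpq
    (hu.pow_const (2 / 3 : ℝ)).aemeasurable (hu.pow_const (2 / 3 : ℝ)).aemeasurable
  simp only [Pi.mul_apply, ← ENNReal.rpow_mul,
    ← ENNReal.rpow_add_of_nonneg _ _ (by norm_num : (0 : ℝ) ≤ 2 / 3)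
      (by norm_num : (0 : ℝ) ≤ 2 / 3)] at h2
  norm_num at h2
  refine (pow_le_pow_left' ((h n u u hu hu).trans (mul_le_mul_left
    (ENNReal.rpow_le_rpow h2 (by norm_num)) _)) 4).trans_eq ?_
  simp only [mul_pow, ENNReal.mul_rpow_of_nonneg _ _ (by norm_num : (0 : ℝ) ≤ 3 / 4),
    ← ENNReal.rpow_natCast, ← ENNReal.rpow_mul, mul_assoc]
  norm_num
  rw [← pow_succ']

lemma measurePreserving_prodProdProdComm {α β γ δ : Type*} [MeasurableSpace α]
    [MeasurableSpace β] [MeasurableSpace γ] [MeasurableSpace δ] (μ : Measure α) (ν : Measure β)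
    (ξ : Measure γ) (ζ : Measure δ) [SFinite μ] [SFinite ν] [SFinite ξ] [SFinite ζ] :
    MeasurePreserving (fun r : (α × β) × γ × δ ↦ ((r.1.1, r.2.1), (r.1.2, r.2.2)))
      ((μ.prod ν).prod (ξ.prod ζ)) ((μ.prod ξ).prod (ν.prod ζ)) :=
  ((((measurePreserving_prodAssoc μ ξ (ν.prod ζ)).symm).comp
    ((MeasurePreserving.id μ).prod (measurePreserving_prodAssoc ξ ν ζ))).comp
    ((MeasurePreserving.id μ).prod (Measure.measurePreserving_swap.prod
      (MeasurePreserving.id ζ)))).comp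
    (((MeasurePreserving.id μ).prod (measurePreserving_prodAssoc ν ξ ζ).symm).comp
      (measurePreserving_prodAssoc μ ν (ξ.prod ζ)))

lemma measurePreserving_cons_prod_cons (n : ℕ) :
    MeasurePreserving (fun r : (ℝ × ℝ) × (Fin n → ℝ) × (Fin n → ℝ) ↦
        ((Fin.cons r.1.1 r.2.1 : Fin (n + 1) → ℝ), (Fin.cons r.1.2 r.2.2 : Fin (n + 1) → ℝ)))
      (((gaussianReal 0 1).prod (gaussianReal 0 1)).prod
        ((_root_.stdGaussian n).prod (_root_.stdGaussian n)))
      ((_root_.stdGaussian (n + 1)).prod (_root_.stdGaussian (n + 1))) :=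
  ((measurePreserving_cons n).prod (measurePreserving_cons n)).comp
    (measurePreserving_prodProdProdComm _ _ _ _)

/-- The correlation `E g(X) g(ρX + √(1 - ρ²)Y)` for independent standard Gaussian `X`, `Y`. -/
noncomputable def mehlerCorr {n : ℕ} (ρ : ℝ) (g : (Fin n → ℝ) → ℝ) : ℝ :=
  ∫ q, g q.1 * g (ρ • q.1 + √(1 - ρ ^ 2) • q.2)
    ∂((_root_.stdGaussian n).prod (_root_.stdGaussian n))

/-- The `L¹` influence of the `i`-th coordinate. -/
noncomputable def influence {n : ℕ} (g : (Fin n → ℝ) → ℝ) (i : Fin n) : ℝ :=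
  ∫ q, |g q.1 - g (Function.update q.1 i q.2)| ∂((_root_.stdGaussian n).prod (gaussianReal 0 1))

lemma integral_comp_measurePreserving {α β : Type*} [MeasurableSpace α] [MeasurableSpace β]
    {μ : Measure α} {ν : Measure β} {φ : α → β} (h : MeasurePreserving φ μ ν) {F : β → ℝ}
    (hF : Measurable F) : ∫ a, F (φ a) ∂μ = ∫ b, F b ∂ν := by
  rw [← h.map_eq, integral_map h.measurable.aemeasurable hF.aestronglyMeasurable]

lemma measurePreserving_mehler {E : Type*} [NormedAddCommGroup E] [NormedSpace ℝ E]
    [MeasurableSpace E] [BorelSpace E] [SecondCountableTopology E] [CompleteSpace E]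
    {μ : Measure E} [IsGaussian μ] (hμ : μ[id] = 0) {ρ : ℝ} (h0 : 0 ≤ ρ) (h1 : ρ ≤ 1) :
    MeasurePreserving (fun p : E × E ↦ ρ • p.1 + √(1 - ρ ^ 2) • p.2) (μ.prod μ) μ := by
  have := measurePreserving_fst.comp (measurePreserving_rotation hμ (arccos ρ))
  simpa [Function.comp_def, Real.cos_arccos (by linarith : -1 ≤ ρ) h1, Real.sin_arccos] using this

lemma measurePreserving_mehler_stdGaussian (n : ℕ) {ρ : ℝ} (h0 : 0 ≤ ρ) (h1 : ρ ≤ 1) :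
    MeasurePreserving (fun p : (Fin n → ℝ) × (Fin n → ℝ) ↦ ρ • p.1 + √(1 - ρ ^ 2) • p.2)
      ((_root_.stdGaussian n).prod (_root_.stdGaussian n)) (_root_.stdGaussian n) :=
  measurePreserving_mehler (integral_id_stdGaussian n) h0 h1

lemma integral_prod_eq_zero_of_left {α β : Type*} [MeasurableSpace α] [MeasurableSpace β]
    {μ : Measure α} {ν : Measure β} [IsFiniteMeasure μ] [IsFiniteMeasure ν] {F : α × β → ℝ}
    (hF : Measurable F) {C : ℝ} (hC : ∀ r, |F r| ≤ C) (h : ∀ b, ∫ a, F (a, b) ∂μ = 0) :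
    ∫ r, F r ∂(μ.prod ν) = 0 := by
  rw [integral_prod_symm _ (integrable_of_bound hF hC)]
  simp [h]

lemma abs_mul_le_of_bound {x y C D : ℝ} (hx : |x| ≤ C) (hy : |y| ≤ D) : |x * y| ≤ C * D := by
  rw [abs_mul]
  exact mul_le_mul hx hy (abs_nonneg _) ((abs_nonneg _).trans hx)

lemma rpow_mul_rpow_add_le {a b c d : ℝ} (ha : 0 ≤ a) (hb : 0 ≤ b) (hc : 0 ≤ c) (hd : 0 ≤ d) :
    a ^ (3 / 4 : ℝ) * b ^ (1 / 4 : ℝ) + c ^ (3 / 4 : ℝ) * d ^ (1 / 4 : ℝ)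
      ≤ (a + c) ^ (3 / 4 : ℝ) * (b + d) ^ (1 / 4 : ℝ) := by
  have hpq : (4 / 3 : ℝ).HolderConjugate 4 := by
    rw [Real.holderConjugate_iff]; norm_num
  have h := Real.inner_le_Lp_mul_Lq_of_nonneg (Finset.univ : Finset (Fin 2))
    (f := ![a ^ (3 / 4 : ℝ), c ^ (3 / 4 : ℝ)]) (g := ![b ^ (1 / 4 : ℝ), d ^ (1 / 4 : ℝ)]) hpq
    (by intro i _; fin_cases i <;> simp <;> positivity)
    (by intro i _; fin_cases i <;> simp <;> positivity)
  simp only [Fin.sum_univ_two, Matrix.cons_val_zero, Matrix.cons_val_one,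
    ← Real.rpow_mul ha, ← Real.rpow_mul hb, ← Real.rpow_mul hc, ← Real.rpow_mul hd] at h
  norm_num at h ⊢
  exact h

/-- The `L⁴`-`L²` hypercontractive estimate in interpolated form. -/
def IsHypercontractive (ρ : ℝ) : Prop :=
  0 < ρ ∧ ρ < 1 ∧ ∀ (n : ℕ) (u : (Fin n → ℝ) → ENNReal), Measurable u →
    (∫⁻ x, ∫⁻ y, u x * u (ρ • x + √(1 - ρ ^ 2) • y)
      ∂_root_.stdGaussian n ∂_root_.stdGaussian n) ^ 4
      ≤ (∫⁻ x, u x ∂_root_.stdGaussian n) ^ 2 * (∫⁻ x, u x ^ 2 ∂_root_.stdGaussian n) ^ 3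

lemma mehlerCorr_le_of_isHypercontractive {ρ : ℝ} (h : IsHypercontractive ρ) {n : ℕ}
    {g : (Fin n → ℝ) → ℝ} (hg : Measurable g) {C : ℝ} (hC : ∀ x, |g x| ≤ C) :
    mehlerCorr ρ g ≤ (∫ x, g x ^ 2 ∂_root_.stdGaussian n) ^ (3 / 4 : ℝ) *
      ((∫ x, |g x| ∂_root_.stdGaussian n) ^ 2) ^ (1 / 4 : ℝ) := by
  have hg2 : Measurable fun q : (Fin n → ℝ) × (Fin n → ℝ) ↦ g (ρ • q.1 + √(1 - ρ ^ 2) • q.2) :=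
    hg.comp (by fun_prop)
  have hg1 : Measurable fun q : (Fin n → ℝ) × (Fin n → ℝ) ↦ g q.1 := hg.comp measurable_fst
  set J := ∫ q : (Fin n → ℝ) × (Fin n → ℝ), |g q.1| * |g (ρ • q.1 + √(1 - ρ ^ 2) • q.2)|
    ∂((_root_.stdGaussian n).prod (_root_.stdGaussian n)) with hJ
  have hJm : Measurable fun q : (Fin n → ℝ) × (Fin n → ℝ) ↦
      |g q.1| * |g (ρ • q.1 + √(1 - ρ ^ 2) • q.2)| := by fun_prop
  have hJ0 : 0 ≤ J := integral_nonneg fun _ ↦ by positivity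
  have hle : mehlerCorr ρ g ≤ J :=
    integral_mono (integrable_of_bound (hg1.mul hg2) fun q ↦ abs_mul_le_of_bound (hC _) (hC _))
      (integrable_of_bound hJm (C := C * C) fun q ↦
        abs_mul_le_of_bound (by rw [abs_abs]; exact hC _) (by rw [abs_abs]; exact hC _))
      fun q ↦ by rw [← abs_mul]; exact le_abs_self _
  have h4 := h.2.2 n (fun x ↦ ENNReal.ofReal |g x|) (by fun_prop)
  have hJe : ∫⁻ x, ∫⁻ y, ENNReal.ofReal |g x| * ENNReal.ofReal |g (ρ • x + √(1 - ρ ^ 2) • y)|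
      ∂_root_.stdGaussian n ∂_root_.stdGaussian n = ENNReal.ofReal J := by
    rw [hJ, ofReal_integral_eq_lintegral_ofReal (integrable_of_bound hJm (C := C * C) fun q ↦
        abs_mul_le_of_bound (by rw [abs_abs]; exact hC _) (by rw [abs_abs]; exact hC _))
      (Filter.Eventually.of_forall fun _ ↦ by positivity), lintegral_prod _ (by fun_prop)]
    simp_rw [ENNReal.ofReal_mul (abs_nonneg _)]
  rw [hJe, ← ENNReal.ofReal_pow hJ0, ← ofReal_integral_eq_lintegral_ofReal
    (integrable_of_bound (by fun_prop) (C := C) fun x ↦ by rw [abs_abs]; exact hC x)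
    (Filter.Eventually.of_forall fun _ ↦ abs_nonneg _)] at h4
  simp_rw [← ENNReal.ofReal_pow (abs_nonneg _), sq_abs] at h4
  rw [← ofReal_integral_eq_lintegral_ofReal (integrable_pow_of_bound 2 hg hC)
    (Filter.Eventually.of_forall fun _ ↦ sq_nonneg _),
    ← ENNReal.ofReal_pow (integral_nonneg fun _ ↦ abs_nonneg _),
    ← ENNReal.ofReal_pow (integral_nonneg fun _ ↦ sq_nonneg _),
    ← ENNReal.ofReal_mul (by positivity), ENNReal.ofReal_le_ofReal_iff
      (mul_nonneg (by positivity) (pow_nonneg (integral_nonneg fun _ ↦ sq_nonneg _) _))] at h4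
  have hE : 0 ≤ ∫ x, g x ^ 2 ∂_root_.stdGaussian n := integral_nonneg fun _ ↦ sq_nonneg _
  refine hle.trans ?_
  have h5 := Real.rpow_le_rpow (by positivity) h4 (by norm_num : (0 : ℝ) ≤ 1 / 4)
  rw [Real.mul_rpow (by positivity) (by positivity), ← Real.rpow_natCast J,
    ← Real.rpow_mul hJ0, ← Real.rpow_natCast (∫ x, g x ^ 2 ∂_root_.stdGaussian n),
    ← Real.rpow_mul hE] at h5
  norm_num at h5 ⊢
  exact h5.trans_eq (mul_comm _ _)

/-- Average over the zeroth coordinate. -/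
noncomputable def headAverage {n : ℕ} (g : (Fin (n + 1) → ℝ) → ℝ) (x : Fin n → ℝ) : ℝ :=
  ∫ x₀, g (Fin.cons x₀ x) ∂gaussianReal 0 1

/-- The fluctuation in the zeroth coordinate. -/
noncomputable def headFluctuation {n : ℕ} (g : (Fin (n + 1) → ℝ) → ℝ) (x : Fin (n + 1) → ℝ) : ℝ :=
  g x - headAverage g (Fin.tail x)

section

variable {n : ℕ} {g : (Fin (n + 1) → ℝ) → ℝ} (hg : Measurable g) {C : ℝ} (hC : ∀ x, |g x| ≤ C)

include hg in
lemma measurable_headAverage : Measurable (headAverage g) := by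
  have : StronglyMeasurable fun q : (Fin n → ℝ) × ℝ ↦ g (Fin.cons q.2 q.1) :=
    (hg.comp ((measurePreserving_cons n).measurable.comp measurable_swap)).stronglyMeasurable
  exact this.integral_prod_right.measurable

include hC in
lemma abs_headAverage_le (x : Fin n → ℝ) : |headAverage g x| ≤ C :=
  abs_integral_le_of_bound _ fun _ ↦ hC _

lemma measurable_tail : Measurable (Fin.tail : (Fin (n + 1) → ℝ) → Fin n → ℝ) :=
  measurable_pi_iff.2 fun i ↦ measurable_pi_apply i.succ

include hg in
lemma measurable_headFluctuation : Measurable (headFluctuation g) :=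
  hg.sub ((measurable_headAverage hg).comp measurable_tail)

include hC in
lemma abs_headFluctuation_le (x : Fin (n + 1) → ℝ) : |headFluctuation g x| ≤ 2 * C := by
  have := abs_sub (g x) (headAverage g (Fin.tail x))
  have h1 := hC x
  have h2 := abs_headAverage_le hC (Fin.tail x)
  unfold headFluctuation
  linarith

lemma measurable_cons_left (x : Fin n → ℝ) :
    Measurable fun x₀ : ℝ ↦ (Fin.cons x₀ x : Fin (n + 1) → ℝ) :=
  (measurePreserving_cons n).measurable.comp measurable_prodMk_right

include hg hC in
lemma integral_headFluctuation_cons (x : Fin n → ℝ) :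
    ∫ x₀, headFluctuation g (Fin.cons x₀ x) ∂gaussianReal 0 1 = 0 := by
  have h : Measurable fun x₀ ↦ g (Fin.cons x₀ x) := hg.comp (measurable_cons_left x)
  simp only [headFluctuation, Fin.tail_cons]
  rw [integral_sub (integrable_of_bound h fun _ ↦ hC _) (integrable_const _)]
  simp [headAverage]

lemma integral_cons {F : (Fin (n + 1) → ℝ) → ℝ} (hF : Measurable F) {D : ℝ}
    (hD : ∀ x, |F x| ≤ D) :
    ∫ x, F x ∂_root_.stdGaussian (n + 1) =
      ∫ x, ∫ x₀, F (Fin.cons x₀ x) ∂gaussianReal 0 1 ∂_root_.stdGaussian n := by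
  have hm : Measurable fun p : ℝ × (Fin n → ℝ) ↦ F (Fin.cons p.1 p.2) :=
    hF.comp (measurePreserving_cons n).measurable
  rw [← integral_comp_measurePreserving (measurePreserving_cons n) hF,
    integral_prod_symm _ (integrable_of_bound hm fun _ ↦ hD _)]

include hg hC in
lemma integral_headAverage :
    ∫ x, headAverage g x ∂_root_.stdGaussian n = ∫ x, g x ∂_root_.stdGaussian (n + 1) :=
  (integral_cons hg hC).symm

lemma measurePreserving_tail (n : ℕ) : MeasurePreserving
    (Fin.tail : (Fin (n + 1) → ℝ) → Fin n → ℝ) (_root_.stdGaussian (n + 1))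
    (_root_.stdGaussian n) := by
  refine ⟨measurable_tail, ?_⟩
  rw [← (measurePreserving_cons n).map_eq, Measure.map_map measurable_tail
    (measurePreserving_cons n).measurable]
  exact measurePreserving_snd.map_eq

include hg hC in
lemma integral_sq_sub_eq_add :
    ∫ x, (g x - ∫ y, g y ∂_root_.stdGaussian (n + 1)) ^ 2 ∂_root_.stdGaussian (n + 1) =
      ∫ x, (headAverage g x - ∫ y, headAverage g y ∂_root_.stdGaussian n) ^ 2 ∂_root_.stdGaussian n
        + ∫ x, headFluctuation g x ^ 2 ∂_root_.stdGaussian (n + 1) := by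
  rw [integral_headAverage hg hC]
  set m := ∫ y, g y ∂_root_.stdGaussian (n + 1) with hm
  have hmC : |m| ≤ C := abs_integral_le_of_bound _ hC
  have hA := measurable_headAverage hg
  have hAm : Measurable fun x : Fin (n + 1) → ℝ ↦ headAverage g (Fin.tail x) - m :=
    (hA.comp measurable_tail).sub_const m
  have hAC : ∀ x : Fin (n + 1) → ℝ, |headAverage g (Fin.tail x) - m| ≤ C + C := fun x ↦
    (abs_sub _ _).trans (add_le_add (abs_headAverage_le hC _) hmC)
  have hF := measurable_headFluctuation hg
  have hFC := abs_headFluctuation_le hC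
  have hcross : ∫ x, (headAverage g (Fin.tail x) - m) * headFluctuation g x
      ∂_root_.stdGaussian (n + 1) = 0 := by
    have hAF : Measurable fun x ↦ (headAverage g (Fin.tail x) - m) * headFluctuation g x :=
      hAm.mul hF
    rw [integral_cons hAF fun x ↦ abs_mul_le_of_bound (hAC x) (hFC x)]
    simp only [Fin.tail_cons, integral_const_mul,
      integral_headFluctuation_cons hg hC, mul_zero, integral_zero]
  have hexp : ∀ x, (g x - m) ^ 2 = (headAverage g (Fin.tail x) - m) ^ 2
      + 2 * ((headAverage g (Fin.tail x) - m) * headFluctuation g x)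
      + headFluctuation g x ^ 2 := fun x ↦ by unfold headFluctuation; ring
  simp_rw [hexp]
  have hi1 := integrable_pow_of_bound (μ := _root_.stdGaussian (n + 1)) 2 hAm hAC
  have hi2 := (integrable_of_bound (μ := _root_.stdGaussian (n + 1)) (hAm.mul hF)
    fun x ↦ abs_mul_le_of_bound (hAC x) (hFC x)).const_mul 2
  have hi3 := integrable_pow_of_bound (μ := _root_.stdGaussian (n + 1)) 2 hF hFC
  rw [integral_add (by exact hi1.add hi2) hi3, integral_add hi1 (by exact hi2),
    integral_const_mul, hcross, mul_zero, add_zero]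
  congr 1
  exact integral_comp_measurePreserving (measurePreserving_tail n)
    (F := fun x ↦ (headAverage g x - m) ^ 2) ((hA.sub_const m).pow_const 2)

include hg hC in
lemma mehlerCorr_eq_add {ρ : ℝ} (h0 : 0 ≤ ρ) (h1 : ρ ≤ 1) :
    mehlerCorr ρ g = mehlerCorr ρ (headAverage g) + mehlerCorr ρ (headFluctuation g) := by
  set P := (_root_.stdGaussian (n + 1)).prod (_root_.stdGaussian (n + 1)) with hP
  have hA := measurable_headAverage hg
  have hF := measurable_headFluctuation hg
  have hFC := abs_headFluctuation_le hC
  have hrot : Measurable fun q : (Fin (n + 1) → ℝ) × (Fin (n + 1) → ℝ) ↦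
    ρ • q.1 + √(1 - ρ ^ 2) • q.2 := by fun_prop
  have hA1 : Measurable fun q : (Fin (n + 1) → ℝ) × (Fin (n + 1) → ℝ) ↦
    headAverage g (Fin.tail q.1) := hA.comp (measurable_tail.comp measurable_fst)
  have hA2 : Measurable fun q : (Fin (n + 1) → ℝ) × (Fin (n + 1) → ℝ) ↦
    headAverage g (Fin.tail (ρ • q.1 + √(1 - ρ ^ 2) • q.2)) := hA.comp (measurable_tail.comp hrot)
  have hF1 : Measurable fun q : (Fin (n + 1) → ℝ) × (Fin (n + 1) → ℝ) ↦
    headFluctuation g q.1 := hF.comp measurable_fst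
  have hF2 : Measurable fun q : (Fin (n + 1) → ℝ) × (Fin (n + 1) → ℝ) ↦
    headFluctuation g (ρ • q.1 + √(1 - ρ ^ 2) • q.2) := hF.comp hrot
  have hlin : ∀ (p : ℝ × ℝ) (q : (Fin n → ℝ) × (Fin n → ℝ)),
      ρ • (Fin.cons p.1 q.1 : Fin (n + 1) → ℝ) + √(1 - ρ ^ 2) • (Fin.cons p.2 q.2 : Fin (n + 1) → ℝ)
        = Fin.cons (ρ • p.1 + √(1 - ρ ^ 2) • p.2) (ρ • q.1 + √(1 - ρ ^ 2) • q.2) := by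
    intro p q
    ext j
    refine Fin.cases ?_ (fun j ↦ ?_) j <;> simp
  have hc1 : ∫ q, headFluctuation g q.1 *
      headAverage g (Fin.tail (ρ • q.1 + √(1 - ρ ^ 2) • q.2)) ∂P = 0 := by
    rw [hP, ← integral_comp_measurePreserving (measurePreserving_cons_prod_cons n)
      (F := fun q ↦ headFluctuation g q.1 *
      headAverage g (Fin.tail (ρ • q.1 + √(1 - ρ ^ 2) • q.2))) (hF1.mul hA2)]
    refine integral_prod_eq_zero_of_left
      ((hF1.mul hA2).comp (measurePreserving_cons_prod_cons n).measurable)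
      (fun r ↦ abs_mul_le_of_bound (hFC _) (abs_headAverage_le hC _)) fun q ↦ ?_
    simp only [hlin, Fin.tail_cons]
    rw [integral_mul_const, integral_comp_measurePreserving (measurePreserving_fst)
      (F := fun x₀ ↦ headFluctuation g (Fin.cons x₀ q.1)) (hF.comp (measurable_cons_left _)),
      integral_headFluctuation_cons hg hC, zero_mul]
  have hc2 : ∫ q, headAverage g (Fin.tail q.1) *
      headFluctuation g (ρ • q.1 + √(1 - ρ ^ 2) • q.2) ∂P = 0 := by
    rw [hP, ← integral_comp_measurePreserving (measurePreserving_cons_prod_cons n)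
      (F := fun q ↦ headAverage g (Fin.tail q.1) *
      headFluctuation g (ρ • q.1 + √(1 - ρ ^ 2) • q.2)) (hA1.mul hF2)]
    refine integral_prod_eq_zero_of_left
      ((hA1.mul hF2).comp (measurePreserving_cons_prod_cons n).measurable)
      (fun r ↦ abs_mul_le_of_bound (abs_headAverage_le hC _) (hFC _)) fun q ↦ ?_
    simp only [hlin, Fin.tail_cons]
    rw [integral_const_mul, integral_comp_measurePreserving
      (measurePreserving_mehler (μ := gaussianReal 0 1) (by simp) h0 h1)
      (F := fun x₀ ↦ headFluctuation g (Fin.cons x₀ (ρ • q.1 + √(1 - ρ ^ 2) • q.2)))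
      (hF.comp (measurable_cons_left _)), integral_headFluctuation_cons hg hC, mul_zero]
  have hAA : ∫ q, headAverage g (Fin.tail q.1) *
      headAverage g (Fin.tail (ρ • q.1 + √(1 - ρ ^ 2) • q.2)) ∂P = mehlerCorr ρ (headAverage g) :=
    integral_comp_measurePreserving ((measurePreserving_tail n).prod (measurePreserving_tail n))
      (F := fun q ↦ headAverage g q.1 * headAverage g (ρ • q.1 + √(1 - ρ ^ 2) • q.2))
      ((hA.comp measurable_fst).mul (hA.comp (by fun_prop)))
  have hexp : ∀ q : (Fin (n + 1) → ℝ) × (Fin (n + 1) → ℝ),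
      g q.1 * g (ρ • q.1 + √(1 - ρ ^ 2) • q.2) =
      headAverage g (Fin.tail q.1) * headAverage g (Fin.tail (ρ • q.1 + √(1 - ρ ^ 2) • q.2)) +
      headFluctuation g q.1 * headAverage g (Fin.tail (ρ • q.1 + √(1 - ρ ^ 2) • q.2)) +
      headAverage g (Fin.tail q.1) * headFluctuation g (ρ • q.1 + √(1 - ρ ^ 2) • q.2) +
      headFluctuation g q.1 * headFluctuation g (ρ • q.1 + √(1 - ρ ^ 2) • q.2) := fun q ↦ by
    unfold headFluctuation; ring
  have hi1 := integrable_of_bound (μ := P) (hA1.mul hA2) fun q ↦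
    abs_mul_le_of_bound (abs_headAverage_le hC _) (abs_headAverage_le hC _)
  have hi2 := integrable_of_bound (μ := P) (hF1.mul hA2) fun q ↦
    abs_mul_le_of_bound (hFC _) (abs_headAverage_le hC _)
  have hi3 := integrable_of_bound (μ := P) (hA1.mul hF2) fun q ↦
    abs_mul_le_of_bound (abs_headAverage_le hC _) (hFC _)
  have hi4 := integrable_of_bound (μ := P) (hF1.mul hF2) fun q ↦
    abs_mul_le_of_bound (hFC _) (hFC _)
  rw [mehlerCorr]
  simp_rw [hexp]
  rw [← hP, integral_add (by exact (hi1.add hi2).add hi3) (by exact hi4),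
    integral_add (by exact hi1.add hi2) (by exact hi3),
    integral_add (by exact hi1) (by exact hi2), hc1, hc2, hAA]
  simp [mehlerCorr, hP]

end

lemma measurable_update {n : ℕ} (i : Fin n) :
    Measurable fun q : (Fin n → ℝ) × ℝ ↦ Function.update q.1 i q.2 :=
  measurable_pi_iff.2 fun j ↦ by
    by_cases h : j = i
    · subst h; simpa using measurable_snd
    · simp only [Function.update_of_ne h]
      exact (measurable_pi_apply j).comp measurable_fst

lemma abs_sub_le_of_bound {α : Type*} {g : α → ℝ} {C : ℝ} (hC : ∀ x, |g x| ≤ C) (x y : α) :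
    |g x - g y| ≤ 2 * C :=
  (abs_sub _ _).trans (by linarith [hC x, hC y])

section

variable {n : ℕ}

lemma measurable_influence_integrand {g : (Fin n → ℝ) → ℝ} (hg : Measurable g) (i : Fin n) :
    Measurable fun q : (Fin n → ℝ) × ℝ ↦ |g q.1 - g (Function.update q.1 i q.2)| :=
  continuous_abs.measurable.comp ((hg.comp measurable_fst).sub (hg.comp (measurable_update i)))

lemma influence_nonneg (g : (Fin n → ℝ) → ℝ) (i : Fin n) : 0 ≤ influence g i :=
  integral_nonneg fun _ ↦ abs_nonneg _

variable {g : (Fin (n + 1) → ℝ) → ℝ} (hg : Measurable g) {C : ℝ} (hC : ∀ x, |g x| ≤ C)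

include hg hC in
lemma integral_abs_headFluctuation_le :
    ∫ x, |headFluctuation g x| ∂_root_.stdGaussian (n + 1) ≤ influence g 0 := by
  have hm := measurable_influence_integrand hg 0
  have hb : ∀ q : (Fin (n + 1) → ℝ) × ℝ, |(|g q.1 - g (Function.update q.1 0 q.2)|)| ≤ 2 * C :=
    fun q ↦ by rw [abs_abs]; exact abs_sub_le_of_bound hC _ _
  rw [influence, integral_prod _ (integrable_of_bound hm hb)]
  refine integral_mono (integrable_of_bound (measurable_headFluctuation hg).abs (C := 2 * C)
    fun x ↦ by rw [abs_abs]; exact abs_headFluctuation_le hC x)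
    (integrable_of_bound hm.stronglyMeasurable.integral_prod_right'.measurable
      fun x ↦ abs_integral_le_of_bound _ fun y ↦ hb (x, y)) fun x ↦ ?_
  have hup : ∀ y : ℝ, Function.update x 0 y = Fin.cons y (Fin.tail x) := fun y ↦ by
    ext j
    refine Fin.cases ?_ (fun j ↦ ?_) j <;> simp [Fin.tail]
  have hgx : Measurable fun y : ℝ ↦ g (Fin.cons y (Fin.tail x)) :=
    hg.comp (measurable_cons_left _)
  have heq : headFluctuation g x =
      ∫ y, (g x - g (Fin.cons y (Fin.tail x))) ∂gaussianReal 0 1 := by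
    rw [integral_sub (integrable_const _) (integrable_of_bound hgx fun _ ↦ hC _)]
    simp [headFluctuation, headAverage]
  simp only [heq, hup]
  exact abs_integral_le_integral_abs

include hg hC in
lemma influence_headAverage_le (i : Fin n) :
    influence (headAverage g) i ≤ influence g i.succ := by
  have hm := measurable_influence_integrand hg i.succ
  have hb : ∀ q : (Fin (n + 1) → ℝ) × ℝ,
      |(|g q.1 - g (Function.update q.1 i.succ q.2)|)| ≤ 2 * C :=
    fun q ↦ by rw [abs_abs]; exact abs_sub_le_of_bound hC _ _
  have hm' := measurable_influence_integrand (measurable_headAverage hg) i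
  have hb' : ∀ q : (Fin n → ℝ) × ℝ,
      |(|headAverage g q.1 - headAverage g (Function.update q.1 i q.2)|)| ≤ 2 * C :=
    fun q ↦ by rw [abs_abs]; exact abs_sub_le_of_bound (abs_headAverage_le hC) _ _
  rw [influence, influence, integral_prod_symm _ (integrable_of_bound hm hb),
    integral_prod_symm _ (integrable_of_bound hm' hb')]
  refine integral_mono (integrable_of_bound
    hm'.stronglyMeasurable.integral_prod_left'.measurable
      fun y ↦ abs_integral_le_of_bound _ fun x ↦ hb' (x, y))
    (integrable_of_bound hm.stronglyMeasurable.integral_prod_left'.measurable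
      fun y ↦ abs_integral_le_of_bound _ fun x ↦ hb (x, y)) fun y ↦ ?_
  have hmy : Measurable fun x : Fin (n + 1) → ℝ ↦ |g x - g (Function.update x i.succ y)| :=
    hm.comp measurable_prodMk_right
  have hmy' : Measurable fun x : Fin n → ℝ ↦
      |headAverage g x - headAverage g (Function.update x i y)| :=
    hm'.comp measurable_prodMk_right
  dsimp only
  rw [integral_cons hmy fun x ↦ hb (x, y)]
  have hmc : Measurable fun q : (Fin n → ℝ) × ℝ ↦ |g (Fin.cons q.2 q.1) -
      g (Function.update (Fin.cons q.2 q.1 : Fin (n + 1) → ℝ) i.succ y)| :=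
    hmy.comp ((measurePreserving_cons n).measurable.comp measurable_swap)
  refine integral_mono (integrable_of_bound hmy' fun x ↦ hb' (x, y))
    (integrable_of_bound hmc.stronglyMeasurable.integral_prod_right'.measurable
      fun x ↦ abs_integral_le_of_bound _ fun x₀ ↦ hb (_, y)) fun x ↦ ?_
  have h1 : ∀ z : Fin n → ℝ, Integrable (fun x₀ ↦ g (Fin.cons x₀ z)) (gaussianReal 0 1) :=
    fun z ↦ integrable_of_bound (hg.comp (measurable_cons_left z)) fun _ ↦ hC _
  dsimp only [headAverage]
  rw [← integral_sub (h1 _) (h1 _)]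
  simp only [Fin.cons_update]
  exact abs_integral_le_integral_abs

end

/-- A Talagrand-type inequality: the low-correlation part of the variance is controlled by
the `L¹` influences. -/
lemma mehlerCorr_sub_sq_le {ρ : ℝ} (hρ : IsHypercontractive ρ) (n : ℕ) {g : (Fin n → ℝ) → ℝ}
    (hg : Measurable g) {C : ℝ} (hC : ∀ x, |g x| ≤ C) :
    mehlerCorr ρ g - (∫ x, g x ∂_root_.stdGaussian n) ^ 2 ≤
      (∫ x, (g x - ∫ y, g y ∂_root_.stdGaussian n) ^ 2 ∂_root_.stdGaussian n) ^ (3 / 4 : ℝ) *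
        (∑ i, influence g i ^ 2) ^ (1 / 4 : ℝ) := by
  induction n generalizing C with
  | zero =>
    have h0 : ∀ x, g x = g 0 := fun x ↦ congrArg g (Subsingleton.elim _ _)
    simp only [mehlerCorr]
    simp_rw [h0]
    simp [sq]
  | succ n ih =>
    have h1 := ih (measurable_headAverage hg) (abs_headAverage_le hC)
    have h2 := mehlerCorr_le_of_isHypercontractive hρ (measurable_headFluctuation hg)
      (abs_headFluctuation_le hC)
    rw [mehlerCorr_eq_add hg hC hρ.1.le hρ.2.1.le, integral_sq_sub_eq_add hg hC,
      ← integral_headAverage hg hC, Fin.sum_univ_succ, add_comm (influence g 0 ^ 2)]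
    have h3 : ((∫ x, |headFluctuation g x| ∂_root_.stdGaussian (n + 1)) ^ 2) ^ (1 / 4 : ℝ) ≤
        (influence g 0 ^ 2) ^ (1 / 4 : ℝ) :=
      Real.rpow_le_rpow (sq_nonneg _) (pow_le_pow_left₀ (integral_nonneg fun _ ↦ abs_nonneg _)
        (integral_abs_headFluctuation_le hg hC) 2) (by norm_num)
    have h4 : (∑ i, influence (headAverage g) i ^ 2) ^ (1 / 4 : ℝ) ≤
        (∑ i : Fin n, influence g i.succ ^ 2) ^ (1 / 4 : ℝ) :=
      Real.rpow_le_rpow (Finset.sum_nonneg fun _ _ ↦ sq_nonneg _) (Finset.sum_le_sum fun i _ ↦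
        pow_le_pow_left₀ (influence_nonneg _ _) (influence_headAverage_le hg hC i) 2)
        (by norm_num)
    have hV1 : 0 ≤ ∫ x, (headAverage g x - ∫ y, headAverage g y ∂_root_.stdGaussian n) ^ 2
        ∂_root_.stdGaussian n := integral_nonneg fun _ ↦ sq_nonneg _
    have hV2 : 0 ≤ ∫ x, headFluctuation g x ^ 2 ∂_root_.stdGaussian (n + 1) :=
      integral_nonneg fun _ ↦ sq_nonneg _
    refine le_trans ?_ (rpow_mul_rpow_add_le hV1
      (Finset.sum_nonneg fun (i : Fin n) _ ↦ sq_nonneg (influence g i.succ)) hV2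
      (sq_nonneg (influence g 0)))
    have h5 := mul_le_mul_of_nonneg_left h3 (Real.rpow_nonneg hV2 (3 / 4))
    have h6 := mul_le_mul_of_nonneg_left h4 (Real.rpow_nonneg hV1 (3 / 4))
    linarith

lemma sq_integral_mul_le_of_bound {Ω : Type*} [MeasurableSpace Ω] (μ : Measure Ω)
    [IsFiniteMeasure μ] {u v : Ω → ℝ} (hu : Measurable u) (hv : Measurable v) {C D : ℝ}
    (hC : ∀ ω, |u ω| ≤ C) (hD : ∀ ω, |v ω| ≤ D) :
    (∫ ω, u ω * v ω ∂μ) ^ 2 ≤ (∫ ω, u ω ^ 2 ∂μ) * ∫ ω, v ω ^ 2 ∂μ := by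
  have h : ∀ s : ℝ, 0 ≤ (∫ ω, u ω ^ 2 ∂μ) * (s * s) + 2 * (∫ ω, u ω * v ω ∂μ) * s
      + ∫ ω, v ω ^ 2 ∂μ := by
    intro s
    have hi1 := (integrable_pow_of_bound (μ := μ) 2 hu hC).mul_const (s * s)
    have hi2 := (integrable_of_bound (μ := μ) (hu.mul hv)
      fun ω ↦ abs_mul_le_of_bound (hC ω) (hD ω)).mul_const (2 * s)
    have hi3 := integrable_pow_of_bound (μ := μ) 2 hv hD
    have h0 : 0 ≤ ∫ ω, (u ω ^ 2 * (s * s) + u ω * v ω * (2 * s) + v ω ^ 2) ∂μ :=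
      integral_nonneg fun ω ↦ by
        have : u ω ^ 2 * (s * s) + u ω * v ω * (2 * s) + v ω ^ 2 = (u ω * s + v ω) ^ 2 := by ring
        simp only [this]; positivity
    rw [integral_add (by exact hi1.add hi2) hi3, integral_add (by exact hi1) (by exact hi2),
      integral_mul_const, integral_mul_const] at h0
    linarith
  have := discrim_le_zero h
  rw [discrim] at this
  linarith

/-- The Mehler (Ornstein-Uhlenbeck) operator. -/
noncomputable def mehlerOp {n : ℕ} (ρ : ℝ) (h : (Fin n → ℝ) → ℝ) (x : Fin n → ℝ) : ℝ :=
  ∫ y, h (ρ • x + √(1 - ρ ^ 2) • y) ∂_root_.stdGaussian n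

section

variable {n : ℕ} {h : (Fin n → ℝ) → ℝ} (hh : Measurable h) {C : ℝ} (hC : ∀ x, |h x| ≤ C) {ρ : ℝ}

include hh in
lemma measurable_mehler (ρ : ℝ) :
    Measurable fun q : (Fin n → ℝ) × (Fin n → ℝ) ↦ h (ρ • q.1 + √(1 - ρ ^ 2) • q.2) :=
  hh.comp (by fun_prop)

include hh in
lemma measurable_mehlerOp (ρ : ℝ) : Measurable (mehlerOp ρ h) :=
  (measurable_mehler hh ρ).stronglyMeasurable.integral_prod_right'.measurable

include hC in
lemma abs_mehlerOp_le (ρ : ℝ) (x : Fin n → ℝ) : |mehlerOp ρ h x| ≤ C :=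
  abs_integral_le_of_bound _ fun _ ↦ hC _

include hh hC in
lemma mehlerCorr_eq_integral_mul_mehlerOp (ρ : ℝ) :
    mehlerCorr ρ h = ∫ x, h x * mehlerOp ρ h x ∂_root_.stdGaussian n := by
  have hm : Measurable fun q : (Fin n → ℝ) × (Fin n → ℝ) ↦
      h q.1 * h (ρ • q.1 + √(1 - ρ ^ 2) • q.2) :=
    (hh.comp measurable_fst).mul (measurable_mehler hh ρ)
  rw [mehlerCorr, integral_prod _ (integrable_of_bound hm
    fun _ ↦ abs_mul_le_of_bound (hC _) (hC _))]
  simp only [integral_const_mul, mehlerOp]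

include hh hC in
lemma integral_mehlerOp_sq (h0 : 0 ≤ ρ) (h1 : ρ ≤ 1) :
    ∫ x, mehlerOp ρ h x ^ 2 ∂_root_.stdGaussian n = mehlerCorr (ρ ^ 2) h := by
  set γ := _root_.stdGaussian n with hγ
  set σ := √(1 - ρ ^ 2) with hσ
  have hσ2 : σ ^ 2 = 1 - ρ ^ 2 := Real.sq_sqrt (by nlinarith)
  let G : ((Fin n → ℝ) × (Fin n → ℝ)) × (Fin n → ℝ) → ℝ := fun q ↦
    h (ρ • q.1.1 + σ • q.1.2) * h (ρ • q.1.1 + σ • q.2)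
  let H : ((Fin n → ℝ) × (Fin n → ℝ)) × (Fin n → ℝ) → ℝ := fun q ↦
    h q.1.1 * h (ρ ^ 2 • q.1.1 + σ • (q.2 - ρ • q.1.2))
  let K : (Fin n → ℝ) × (Fin n → ℝ) → ℝ := fun q ↦
    h q.1 * h (ρ ^ 2 • q.1 + √(1 - (ρ ^ 2) ^ 2) • q.2)
  have hGm : Measurable G := (hh.comp (by fun_prop)).mul (hh.comp (by fun_prop))
  have hHm : Measurable H := (hh.comp (by fun_prop)).mul (hh.comp (by fun_prop))
  have hKm : Measurable K := (hh.comp (by fun_prop)).mul (hh.comp (by fun_prop))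
  have e1 : ∫ x, mehlerOp ρ h x ^ 2 ∂γ = ∫ q, G q ∂((γ.prod γ).prod γ) := by
    rw [← integral_comp_measurePreserving (measurePreserving_prodAssoc γ γ γ).symm hGm,
      integral_prod (fun q ↦ G (MeasurableEquiv.prodAssoc.symm q))
        (integrable_of_bound (hGm.comp (MeasurableEquiv.measurable _))
          fun _ ↦ abs_mul_le_of_bound (hC _) (hC _))]
    refine integral_congr_ae (Filter.Eventually.of_forall fun x ↦ ?_)
    simp only
    rw [sq, mehlerOp, ← integral_prod_mul]
    rfl
  have hrot := (measurePreserving_rot_stdGaussian n (arccos ρ)).prod (MeasurePreserving.id γ)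
  have e2 : ∫ q, G q ∂((γ.prod γ).prod γ) = ∫ q, H q ∂((γ.prod γ).prod γ) := by
    rw [← integral_comp_measurePreserving hrot hHm]
    refine integral_congr_ae (Filter.Eventually.of_forall fun q ↦ ?_)
    simp only [G, H, Prod.map, id, Real.cos_arccos (by linarith : -1 ≤ ρ) h1, Real.sin_arccos,
      ← hσ]
    congr 2
    ext i
    simp only [Pi.add_apply, Pi.smul_apply, Pi.sub_apply, smul_eq_mul]
    linear_combination (-ρ * q.1.1 i) * hσ2
  have hrot2 := (MeasurePreserving.id γ).prod (measurePreserving_fst.comp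
    ((measurePreserving_rot_stdGaussian n (-arctan ρ)).comp
      (Measure.measurePreserving_swap (μ := γ) (ν := γ))))
  have hτ : √(1 - (ρ ^ 2) ^ 2) = σ * √(1 + ρ ^ 2) := by
    rw [hσ, ← Real.sqrt_mul (by nlinarith)]
    congr 1; ring
  have hne : √(1 + ρ ^ 2) ≠ 0 := (Real.sqrt_pos.2 (by positivity)).ne'
  rw [e1, e2, ← integral_comp_measurePreserving (measurePreserving_prodAssoc γ γ γ).symm hHm]
  change _ = ∫ q, K q ∂γ.prod γ
  rw [← integral_comp_measurePreserving hrot2 hKm]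
  refine integral_congr_ae (Filter.Eventually.of_forall fun q ↦ ?_)
  simp only [H, K, Prod.map, id, Function.comp, Real.cos_neg, Real.sin_neg, Real.cos_arctan,
    Real.sin_arctan, hτ]
  change h q.1 * h (ρ ^ 2 • q.1 + σ • (q.2.2 - ρ • q.2.1)) = _
  congr 2
  ext i
  simp only [Pi.add_apply, Pi.smul_apply, Pi.sub_apply, smul_eq_mul, Prod.fst_swap, Prod.snd_swap]
  field_simp
  ring

include hh hC in
lemma mehlerCorr_sq_le (h0 : 0 ≤ ρ) (h1 : ρ ≤ 1) :
    mehlerCorr ρ h ^ 2 ≤ (∫ x, h x ^ 2 ∂_root_.stdGaussian n) * mehlerCorr (ρ ^ 2) h := by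
  rw [mehlerCorr_eq_integral_mul_mehlerOp hh hC, ← integral_mehlerOp_sq hh hC h0 h1]
  exact sq_integral_mul_le_of_bound _ hh (measurable_mehlerOp hh ρ) hC (abs_mehlerOp_le hC ρ)

include hh hC in
lemma mehlerCorr_sub_integral (h0 : 0 ≤ ρ) (h1 : ρ ≤ 1) :
    mehlerCorr ρ (fun x ↦ h x - ∫ y, h y ∂_root_.stdGaussian n) =
      mehlerCorr ρ h - (∫ x, h x ∂_root_.stdGaussian n) ^ 2 := by
  set γ := _root_.stdGaussian n with hγ
  set m := ∫ x, h x ∂γ with hm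
  have hm1 : Measurable fun q : (Fin n → ℝ) × (Fin n → ℝ) ↦ h q.1 := hh.comp measurable_fst
  have hm2 := measurable_mehler hh ρ
  have hi1 : Integrable (fun q : (Fin n → ℝ) × (Fin n → ℝ) ↦
      h q.1 * h (ρ • q.1 + √(1 - ρ ^ 2) • q.2)) (γ.prod γ) :=
    integrable_of_bound (hm1.mul hm2) fun _ ↦ abs_mul_le_of_bound (hC _) (hC _)
  have hi2 : Integrable (fun q : (Fin n → ℝ) × (Fin n → ℝ) ↦ m * h q.1) (γ.prod γ) :=
    (integrable_of_bound hm1 fun _ ↦ hC _).const_mul m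
  have hi3 : Integrable (fun q : (Fin n → ℝ) × (Fin n → ℝ) ↦
      m * h (ρ • q.1 + √(1 - ρ ^ 2) • q.2)) (γ.prod γ) :=
    (integrable_of_bound hm2 fun _ ↦ hC _).const_mul m
  have hexp : ∀ q : (Fin n → ℝ) × (Fin n → ℝ),
      (h q.1 - m) * (h (ρ • q.1 + √(1 - ρ ^ 2) • q.2) - m) =
        h q.1 * h (ρ • q.1 + √(1 - ρ ^ 2) • q.2) - m * h q.1
          - m * h (ρ • q.1 + √(1 - ρ ^ 2) • q.2) + m ^ 2 := fun q ↦ by ring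
  have e1 : ∫ q : (Fin n → ℝ) × (Fin n → ℝ), h q.1 ∂(γ.prod γ) = m :=
    integral_comp_measurePreserving measurePreserving_fst hh
  have e2 : ∫ q : (Fin n → ℝ) × (Fin n → ℝ), h (ρ • q.1 + √(1 - ρ ^ 2) • q.2) ∂(γ.prod γ) = m :=
    integral_comp_measurePreserving (measurePreserving_mehler_stdGaussian n h0 h1) hh
  simp only [mehlerCorr, hexp]
  rw [integral_add (by exact (hi1.sub hi2).sub hi3) (integrable_const _),
    integral_sub (by exact hi1.sub hi2) hi3, integral_sub hi1 hi2, integral_const_mul,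
    integral_const_mul, e1, e2]
  simp
  ring

/-- Interpolated small-time decay of correlations in terms of the influences. -/
lemma mehlerCorr_rpow_le {g : (Fin n → ℝ) → ℝ} {r : ℝ} (hr : IsHypercontractive r)
    (hg : Measurable g) {C : ℝ} (hC : ∀ x, |g x| ≤ C) (k : ℕ) :
    mehlerCorr (r ^ ((1 / 2 : ℝ) ^ k)) (fun x ↦ g x - ∫ y, g y ∂_root_.stdGaussian n) ≤
      (∫ x, (g x - ∫ y, g y ∂_root_.stdGaussian n) ^ 2 ∂_root_.stdGaussian n)
          ^ (1 - (1 / 2 : ℝ) ^ k / 4) *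
        (∑ i, influence g i ^ 2) ^ ((1 / 2 : ℝ) ^ k / 4) := by
  have hS : 0 ≤ ∑ i, influence g i ^ 2 := Finset.sum_nonneg fun _ _ ↦ sq_nonneg _
  have hV : 0 ≤ ∫ x, (g x - ∫ y, g y ∂_root_.stdGaussian n) ^ 2 ∂_root_.stdGaussian n :=
    integral_nonneg fun _ ↦ sq_nonneg _
  induction k with
  | zero =>
    rw [pow_zero, Real.rpow_one, mehlerCorr_sub_integral hg hC hr.1.le hr.2.1.le]
    convert mehlerCorr_sub_sq_le hr n hg hC using 3
    norm_num
  | succ k ih =>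
    set V := ∫ x, (g x - ∫ y, g y ∂_root_.stdGaussian n) ^ 2 ∂_root_.stdGaussian n
    set S := ∑ i, influence g i ^ 2
    set e := (1 / 2 : ℝ) ^ k with he
    have he0 : 0 < e := by positivity
    have he1 : e ≤ 1 := pow_le_one₀ (by norm_num) (by norm_num)
    have hpow : (1 / 2 : ℝ) ^ (k + 1) = e / 2 := by rw [pow_succ]; ring
    have hsq : (r ^ (e / 2)) ^ 2 = r ^ e := by
      rw [← Real.rpow_natCast, ← Real.rpow_mul hr.1.le]; norm_num
    have h2 := mehlerCorr_sq_le (ρ := r ^ (e / 2))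
      (hg.sub_const (∫ y, g y ∂_root_.stdGaussian n))
      (C := 2 * C) (fun x ↦ (abs_sub _ _).trans
        (by linarith [hC x, abs_integral_le_of_bound (_root_.stdGaussian n) hC]))
      (Real.rpow_nonneg hr.1.le _) (Real.rpow_le_one hr.1.le hr.2.1.le (by positivity))
    rw [hsq] at h2
    rw [hpow]
    refine le_of_sq_le_sq (h2.trans ((mul_le_mul_of_nonneg_left ih hV).trans_eq ?_))
      (by positivity)
    rw [mul_pow, ← Real.rpow_natCast, ← Real.rpow_natCast, ← Real.rpow_mul hV,
      ← Real.rpow_mul hS, ← mul_assoc]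
    congr 1
    · nth_rewrite 1 [← Real.rpow_one V]
      rw [← Real.rpow_add_of_nonneg hV (by norm_num) (by linarith)]
      congr 1; push_cast; ring
    · congr 1; push_cast; ring

end

lemma lintegral_sq_gaussianReal (w : NNReal) :
    ∫⁻ t, ENNReal.ofReal (t ^ 2) ∂gaussianReal 0 w = w := by
  have h2 : MemLp (fun x : ℝ ↦ x) 2 (gaussianReal 0 w) := memLp_id_gaussianReal 2
  rw [← ofReal_integral_eq_lintegral_ofReal h2.integrable_sq
    (Filter.Eventually.of_forall fun _ ↦ sq_nonneg _)]
  have h3 := variance_id_gaussianReal (μ := 0) (v := w)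
  rw [variance_of_integral_eq_zero aemeasurable_id (by simp)] at h3
  simp only [id] at h3
  rw [h3, ENNReal.ofReal_coe_nnreal]

lemma lintegral_sq_sum_mul_stdGaussian {n : ℕ} (v : Fin n → ℝ) :
    ∫⁻ y, ENNReal.ofReal ((∑ i, v i * y i) ^ 2) ∂_root_.stdGaussian n =
      ENNReal.ofReal (∑ i, v i ^ 2) := by
  have hm : Measurable fun y : Fin n → ℝ ↦ ∑ i, v i * y i := by fun_prop
  rw [← lintegral_map (f := fun s : ℝ ↦ ENNReal.ofReal (s ^ 2)) (by fun_prop) hm,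
    map_sum_mul_stdGaussian, lintegral_sq_gaussianReal]
  rfl

/-- The Dirichlet energy of `g` with respect to the Gaussian measure. -/
noncomputable def energy {n : ℕ} (g : (Fin n → ℝ) → ℝ) : ℝ :=
  ∫ x, ∑ i, partialDeriv g i x ^ 2 ∂_root_.stdGaussian n

section

variable {n : ℕ} {g : (Fin n → ℝ) → ℝ}

lemma energy_nonneg (g : (Fin n → ℝ) → ℝ) : 0 ≤ energy g :=
  integral_nonneg fun _ ↦ Finset.sum_nonneg fun _ _ ↦ sq_nonneg _

lemma measurable_partialDeriv (g : (Fin n → ℝ) → ℝ) (i : Fin n) :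
    Measurable (partialDeriv g i) :=
  measurable_fderiv_apply g measurable_id measurable_const

lemma fderiv_apply_eq_sum (g : (Fin n → ℝ) → ℝ) (x y : Fin n → ℝ) :
    fderiv ℝ g x y = ∑ i, partialDeriv g i x * y i := by
  conv_lhs => rw [pi_eq_sum_univ' y]
  simp [map_sum, partialDeriv, mul_comm]

lemma abs_partialDeriv_le {K : NNReal} (hg : LipschitzWith K g) (i : Fin n) (x : Fin n → ℝ) :
    |partialDeriv g i x| ≤ K := by
  refine (norm_fderiv_apply_le hg x (Pi.single i 1)).trans (mul_le_of_le_one_right K.2 ?_)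
  rw [Pi.norm_single, norm_one]

lemma integrable_sum_sq_partialDeriv {K : NNReal} (hg : LipschitzWith K g) :
    Integrable (fun x ↦ ∑ i, partialDeriv g i x ^ 2) (_root_.stdGaussian n) :=
  integrable_finsetSum _ fun i _ ↦
    integrable_pow_of_bound 2 (measurable_partialDeriv g i) (abs_partialDeriv_le hg i)

lemma integral_sq_increment_le {K : NNReal} (hg : LipschitzWith K g) {C : ℝ}
    (hC : ∀ x, |g x| ≤ C) {θ : ℝ} (hθ : 0 < θ) :
    ∫ q, (g (cos θ • q.1 + sin θ • q.2) - g q.1) ^ 2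
        ∂((_root_.stdGaussian n).prod (_root_.stdGaussian n)) ≤ θ ^ 2 * energy g := by
  have hgm := hg.continuous.measurable
  have h := lintegral_convex_rotation_le hg (Even.convexOn_pow (n := 2) even_two)
    (fun x ↦ sq_nonneg x) hθ
  have hm : Measurable fun q : (Fin n → ℝ) × (Fin n → ℝ) ↦
      g (cos θ • q.1 + sin θ • q.2) - g q.1 :=
    (hgm.comp (by fun_prop)).sub (hgm.comp measurable_fst)
  have hm2 : Measurable fun q : (Fin n → ℝ) × (Fin n → ℝ) ↦ fderiv ℝ g q.1 q.2 :=
    measurable_fderiv_apply g measurable_fst measurable_snd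
  rw [← ofReal_integral_eq_lintegral_ofReal
    (integrable_pow_of_bound 2 hm fun _ ↦ abs_sub_le_of_bound hC _ _)
    (Filter.Eventually.of_forall fun _ ↦ sq_nonneg _), lintegral_prod _ (by fun_prop)] at h
  have hr : ∀ x, ∫⁻ y, ENNReal.ofReal ((θ * fderiv ℝ g x y) ^ 2) ∂_root_.stdGaussian n =
      ENNReal.ofReal (θ ^ 2 * ∑ i, partialDeriv g i x ^ 2) := by
    intro x
    simp_rw [mul_pow, ENNReal.ofReal_mul (sq_nonneg θ), fderiv_apply_eq_sum]
    rw [lintegral_const_mul _ (by fun_prop), lintegral_sq_sum_mul_stdGaussian]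
  simp_rw [hr] at h
  rw [← ofReal_integral_eq_lintegral_ofReal ((integrable_sum_sq_partialDeriv hg).const_mul _)
    (Filter.Eventually.of_forall fun _ ↦
      mul_nonneg (sq_nonneg _) (Finset.sum_nonneg fun _ _ ↦ sq_nonneg _)), integral_const_mul] at h
  exact (ENNReal.ofReal_le_ofReal_iff (mul_nonneg (sq_nonneg _) (energy_nonneg g))).1 h

lemma arccos_sq_le {ρ : ℝ} (h0 : 0 ≤ ρ) (h1 : ρ ≤ 1) : arccos ρ ^ 2 ≤ π ^ 2 / 2 * (1 - ρ) := by
  have h := Real.cos_le_one_sub_mul_cos_sq (x := arccos ρ)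
    (by rw [abs_of_nonneg (arccos_nonneg ρ)]; exact arccos_le_pi ρ)
  rw [Real.cos_arccos (by linarith) h1] at h
  have hp : 0 < π ^ 2 / 2 := by positivity
  calc arccos ρ ^ 2 = π ^ 2 / 2 * (2 / π ^ 2 * arccos ρ ^ 2) := by field_simp
    _ ≤ π ^ 2 / 2 * (1 - ρ) := by gcongr; linarith

lemma variance_sub_mehlerCorr_le {K : NNReal} (hg : LipschitzWith K g) {C : ℝ}
    (hC : ∀ x, |g x| ≤ C) {ρ : ℝ} (h0 : 0 ≤ ρ) (h1 : ρ < 1) :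
    ∫ x, (g x - ∫ y, g y ∂_root_.stdGaussian n) ^ 2 ∂_root_.stdGaussian n
        - mehlerCorr ρ (fun x ↦ g x - ∫ y, g y ∂_root_.stdGaussian n) ≤
      π ^ 2 / 4 * (1 - ρ) * energy g := by
  have hgm := hg.continuous.measurable
  have hθ : 0 < arccos ρ := arccos_pos.2 h1
  have h := (integral_sq_increment_le hg hC hθ).trans
    (mul_le_mul_of_nonneg_right (arccos_sq_le h0 h1.le) (energy_nonneg g))
  rw [Real.cos_arccos (by linarith) h1.le, Real.sin_arccos] at h
  set γ := _root_.stdGaussian n with hγ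
  set m := ∫ y, g y ∂γ
  have hhm : Measurable fun x ↦ g x - m := hgm.sub_const m
  have hhC : ∀ x, |g x - m| ≤ C + |m| := fun x ↦ (abs_sub _ _).trans (by linarith [hC x])
  have hm1 : Measurable fun q : (Fin n → ℝ) × (Fin n → ℝ) ↦ g q.1 - m :=
    hhm.comp measurable_fst
  have hm2 : Measurable fun q : (Fin n → ℝ) × (Fin n → ℝ) ↦
    g (ρ • q.1 + √(1 - ρ ^ 2) • q.2) - m := measurable_mehler hhm ρ
  have hexp : ∀ q : (Fin n → ℝ) × (Fin n → ℝ),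
      (g (ρ • q.1 + √(1 - ρ ^ 2) • q.2) - g q.1) ^ 2 =
        (g (ρ • q.1 + √(1 - ρ ^ 2) • q.2) - m) ^ 2 + (g q.1 - m) ^ 2
        - 2 * ((g q.1 - m) * (g (ρ • q.1 + √(1 - ρ ^ 2) • q.2) - m)) := fun q ↦ by ring
  have hi1 : Integrable (fun q : (Fin n → ℝ) × (Fin n → ℝ) ↦
      (g (ρ • q.1 + √(1 - ρ ^ 2) • q.2) - m) ^ 2) (γ.prod γ) :=
    integrable_pow_of_bound 2 hm2 fun _ ↦ hhC _
  have hi2 : Integrable (fun q : (Fin n → ℝ) × (Fin n → ℝ) ↦ (g q.1 - m) ^ 2) (γ.prod γ) :=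
    integrable_pow_of_bound 2 hm1 fun _ ↦ hhC _
  have hi3 : Integrable (fun q : (Fin n → ℝ) × (Fin n → ℝ) ↦
      2 * ((g q.1 - m) * (g (ρ • q.1 + √(1 - ρ ^ 2) • q.2) - m))) (γ.prod γ) :=
    (integrable_of_bound (hm1.mul hm2) fun _ ↦ abs_mul_le_of_bound (hhC _) (hhC _)).const_mul 2
  have e1 : ∫ q : (Fin n → ℝ) × (Fin n → ℝ), (g q.1 - m) ^ 2 ∂(γ.prod γ) =
      ∫ x, (g x - m) ^ 2 ∂γ :=
    integral_comp_measurePreserving measurePreserving_fst (hhm.pow_const 2)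
  have e2 : ∫ q : (Fin n → ℝ) × (Fin n → ℝ), (g (ρ • q.1 + √(1 - ρ ^ 2) • q.2) - m) ^ 2
      ∂(γ.prod γ) = ∫ x, (g x - m) ^ 2 ∂γ :=
    integral_comp_measurePreserving (measurePreserving_mehler_stdGaussian n h0 h1.le)
      (hhm.pow_const 2)
  simp only [hexp] at h
  rw [integral_sub (by exact hi1.add hi2) hi3, integral_add hi1 hi2, e1, e2,
    integral_const_mul] at h
  change _ - 2 * mehlerCorr ρ (fun x ↦ g x - m) ≤ _ at h
  linarith

/-- The Gaussian Poincaré inequality, up to the value of the constant. -/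
lemma variance_le_energy {K : NNReal} (hg : LipschitzWith K g) {C : ℝ} (hC : ∀ x, |g x| ≤ C) :
    ∫ x, (g x - ∫ y, g y ∂_root_.stdGaussian n) ^ 2 ∂_root_.stdGaussian n ≤
      π ^ 2 / 4 * energy g := by
  have h := variance_sub_mehlerCorr_le hg hC le_rfl zero_lt_one
  rw [mehlerCorr_sub_integral hg.continuous.measurable hC le_rfl zero_le_one] at h
  have h2 : mehlerCorr 0 g = (∫ x, g x ∂_root_.stdGaussian n) ^ 2 := by
    simp [mehlerCorr, sq, integral_prod_mul]
  rw [h2] at h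
  linarith

lemma one_sub_rpow_le {r ε : ℝ} (hr : 0 < r) : 1 - r ^ ε ≤ ε * -Real.log r := by
  have := Real.add_one_le_exp (Real.log r * ε)
  rw [Real.rpow_def_of_pos hr]
  linarith

/-- A Talagrand-type inequality: the variance is bounded by a small multiple of the energy plus
an interpolation between the variance and the influences. -/
lemma variance_le_energy_add {r : ℝ} (hr : IsHypercontractive r) {K : NNReal}
    (hg : LipschitzWith K g) {C : ℝ} (hC : ∀ x, |g x| ≤ C) (k : ℕ) :
    ∫ x, (g x - ∫ y, g y ∂_root_.stdGaussian n) ^ 2 ∂_root_.stdGaussian n ≤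
      π ^ 2 / 4 * -Real.log r * (1 / 2) ^ k * energy g +
      (∫ x, (g x - ∫ y, g y ∂_root_.stdGaussian n) ^ 2 ∂_root_.stdGaussian n)
          ^ (1 - (1 / 2 : ℝ) ^ k / 4) *
        (∑ i, influence g i ^ 2) ^ ((1 / 2 : ℝ) ^ k / 4) := by
  have h1 := variance_sub_mehlerCorr_le hg hC
    (Real.rpow_nonneg hr.1.le ((1 / 2 : ℝ) ^ k)) (Real.rpow_lt_one hr.1.le hr.2.1 (by positivity))
  have h2 := mehlerCorr_rpow_le hr hg.continuous.measurable hC k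
  have h3 := mul_le_mul_of_nonneg_right (mul_le_mul_of_nonneg_left
    (one_sub_rpow_le (ε := (1 / 2 : ℝ) ^ k) hr.1) (by positivity : 0 ≤ π ^ 2 / 4)) (energy_nonneg g)
  linarith

end

lemma lintegral_abs_gaussianReal_le : ∫⁻ t, ENNReal.ofReal |t| ∂gaussianReal 0 1 ≤ 1 := by
  have h := sq_lintegral_le (gaussianReal 0 1) (f := fun t : ℝ ↦ ENNReal.ofReal |t|)
    (by fun_prop)
  simp_rw [← ENNReal.ofReal_pow (abs_nonneg _), sq_abs, lintegral_sq_gaussianReal] at h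
  exact (pow_le_one_iff two_ne_zero).1 (by simpa using h)

lemma measurePreserving_prod_insertNth {n : ℕ} (i : Fin (n + 1)) :
    MeasurePreserving (fun q : (ℝ × ℝ) × (Fin n → ℝ) ↦
        ((i.insertNth q.1.1 q.2 : Fin (n + 1) → ℝ), q.1.2))
      (((gaussianReal 0 1).prod (gaussianReal 0 1)).prod (_root_.stdGaussian n))
      ((_root_.stdGaussian (n + 1)).prod (gaussianReal 0 1)) :=
  ((measurePreserving_insertNth i).prod (MeasurePreserving.id _)).comp
    ((measurePreserving_prodAssoc _ _ _).symm.comp (((MeasurePreserving.id _).prod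
      Measure.measurePreserving_swap).comp (measurePreserving_prodAssoc _ _ _)))

lemma influence_le {n : ℕ} {g : (Fin n → ℝ) → ℝ} {K : NNReal} (hg : LipschitzWith K g) {C : ℝ}
    (hC : ∀ x, |g x| ≤ C) (i : Fin n) :
    influence g i ≤ π / 2 * ∫ x, |partialDeriv g i x| ∂_root_.stdGaussian n := by
  cases n with
  | zero => exact i.elim0
  | succ n =>
    have hgm := hg.continuous.measurable
    have h := lintegral_abs_sub_insertNth_le hg i
    have hm := measurable_influence_integrand hgm i
    have e1 := (measurePreserving_prod_insertNth i).lintegral_comp (f := fun q ↦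
      ENNReal.ofReal |g (Function.update q.1 i q.2) - g q.1|)
        (by simpa only [abs_sub_comm] using hm.ennreal_ofReal)
    have hm2 : Measurable fun q : (Fin (n + 1) → ℝ) × ℝ ↦ π / 2 * (q.2 * partialDeriv g i q.1) :=
      (measurable_snd.mul ((measurable_partialDeriv g i).comp measurable_fst)).const_mul _
    have e2 := (measurePreserving_prod_insertNth i).lintegral_comp (f := fun q ↦
      ENNReal.ofReal |π / 2 * (q.2 * partialDeriv g i q.1)|) hm2.abs.ennreal_ofReal
    simp only [Fin.update_insertNth] at e1
    have hinf : influence g i = ∫ q, |g (Function.update q.1 i q.2) - g q.1|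
        ∂((_root_.stdGaussian (n + 1)).prod (gaussianReal 0 1)) := by
      simp only [influence, fun q : (Fin (n + 1) → ℝ) × ℝ ↦
        abs_sub_comm (g q.1) (g (Function.update q.1 i q.2))]
    rw [e1, e2] at h
    rw [hinf]
    rw [← ofReal_integral_eq_lintegral_ofReal (integrable_of_bound
        (by simpa only [abs_sub_comm] using hm) fun q ↦ by
        rw [abs_abs]; exact abs_sub_le_of_bound hC _ _)
      (Filter.Eventually.of_forall fun _ ↦ abs_nonneg _)] at h
    have e3 : ∫⁻ q : (Fin (n + 1) → ℝ) × ℝ, ENNReal.ofReal |π / 2 * (q.2 * partialDeriv g i q.1)|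
        ∂((_root_.stdGaussian (n + 1)).prod (gaussianReal 0 1)) ≤
        ENNReal.ofReal (π / 2 * ∫ x, |partialDeriv g i x| ∂_root_.stdGaussian (n + 1)) := by
      have hmd := measurable_partialDeriv g i
      simp_rw [abs_mul, abs_of_pos (half_pos pi_pos), mul_comm |(_ : ℝ)| (|partialDeriv g i _|),
        ENNReal.ofReal_mul (half_pos pi_pos).le, ENNReal.ofReal_mul (abs_nonneg _)]
      rw [lintegral_const_mul _ (by fun_prop),
        lintegral_prod_mul (f := fun x ↦ ENNReal.ofReal |partialDeriv g i x|)
          (g := fun t : ℝ ↦ ENNReal.ofReal |t|) (by fun_prop) (by fun_prop),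
        ofReal_integral_eq_lintegral_ofReal
          (integrable_of_bound hmd.abs fun x ↦ by
            rw [abs_abs]; exact abs_partialDeriv_le hg i x)
          (Filter.Eventually.of_forall fun _ ↦ abs_nonneg _)]
      gcongr
      exact mul_le_of_le_one_right' lintegral_abs_gaussianReal_le
    exact (ENNReal.ofReal_le_ofReal_iff (mul_nonneg (half_pos pi_pos).le
      (integral_nonneg fun _ ↦ abs_nonneg _))).1 (h.trans e3)

section

variable {n : ℕ} {f : (Fin n → ℝ) → ℝ}

lemma abs_fderiv_apply_le {N : (Fin n → ℝ) → ℝ} (h : ∀ x y, |f x - f y| ≤ N (x - y))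
    (hN : ∀ (t : ℝ) v, N (t • v) = |t| * N v) (x v : Fin n → ℝ) : |fderiv ℝ f x v| ≤ N v := by
  have hN0 : 0 ≤ N v := by simpa using (abs_nonneg _).trans (h v 0)
  by_cases hd : DifferentiableAt ℝ f x
  · have hline : HasDerivAt (fun t : ℝ ↦ x + t • v) v 0 := by
      simpa using ((hasDerivAt_id (0 : ℝ)).smul_const v).const_add x
    have hx : HasFDerivAt f (fderiv ℝ f x) (x + (0 : ℝ) • v) := by
      simpa using hd.hasFDerivAt
    have hder := hx.comp_hasDerivAt (0 : ℝ) hline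
    have hlip : LipschitzWith ⟨N v, hN0⟩ (f ∘ fun t : ℝ ↦ x + t • v) :=
      LipschitzWith.of_dist_le_mul fun s t ↦ by
        refine (h _ _).trans_eq ?_
        rw [add_sub_add_left_eq_sub, ← sub_smul, hN, mul_comm]
        rfl
    have := norm_deriv_le_of_lipschitz hlip (x₀ := 0)
    rwa [hder.deriv] at this
  · simpa [fderiv_zero_of_not_differentiableAt hd] using hN0

lemma euclNorm_smul (t : ℝ) (v : Fin n → ℝ) : euclNorm (t • v) = |t| * euclNorm v := by
  simp only [euclNorm, Pi.smul_apply, smul_eq_mul, mul_pow, ← Finset.mul_sum]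
  rw [Real.sqrt_mul (sq_nonneg t), Real.sqrt_sq_eq_abs]

lemma sum_sq_partialDeriv_le {b : ℝ}
    (h : ∀ x y, |f x - f y| ≤ b * euclNorm (x - y)) (x : Fin n → ℝ) :
    ∑ i, partialDeriv f i x ^ 2 ≤ b ^ 2 := by
  have h1 := abs_fderiv_apply_le (N := fun v ↦ b * euclNorm v) h
    (fun t v ↦ by rw [euclNorm_smul]; ring) x (fun i ↦ partialDeriv f i x)
  rw [fderiv_apply_eq_sum, euclNorm] at h1
  simp_rw [← sq] at h1
  set s := ∑ i, partialDeriv f i x ^ 2 with hs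
  have hs0 : 0 ≤ s := Finset.sum_nonneg fun _ _ ↦ sq_nonneg _
  rw [abs_of_nonneg hs0] at h1
  rcases hs0.eq_or_lt with h0 | h0
  · rw [← h0]; positivity
  · have h2 : √s ≤ b := by
      refine le_of_mul_le_mul_right ?_ (Real.sqrt_pos.2 h0)
      rwa [Real.mul_self_sqrt hs0]
    calc s = √s ^ 2 := (Real.sq_sqrt hs0).symm
      _ ≤ b ^ 2 := pow_le_pow_left₀ (Real.sqrt_nonneg _) h2 2

lemma sum_abs_partialDeriv_le {a : ℝ} (ha : 0 ≤ a) (h : ∀ x y, |f x - f y| ≤ a * ‖x - y‖)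
    (x : Fin n → ℝ) : ∑ i, |partialDeriv f i x| ≤ a := by
  have h1 := abs_fderiv_apply_le (N := fun v ↦ a * ‖v‖) h
    (fun t v ↦ by rw [norm_smul, Real.norm_eq_abs]; ring) x
    (fun i ↦ SignType.sign (partialDeriv f i x))
  rw [fderiv_apply_eq_sum] at h1
  simp_rw [mul_comm (partialDeriv f _ x), sign_mul_self] at h1
  refine (le_abs_self _).trans (h1.trans (mul_le_of_le_one_right ha ?_))
  refine (pi_norm_le_iff_of_nonneg zero_le_one).2 fun i ↦ ?_
  rcases SignType.trichotomy (SignType.sign (partialDeriv f i x)) with h | h | h <;> simp [h]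

end

lemma abs_exp_sub_exp_le {u v B : ℝ} (hu : u ≤ B) (hv : v ≤ B) :
    |exp u - exp v| ≤ exp B * |u - v| := by
  wlog h : v ≤ u generalizing u v
  · rw [abs_sub_comm, abs_sub_comm u]
    exact this hv hu (le_of_not_ge h)
  rw [abs_of_nonneg (sub_nonneg.2 (exp_le_exp.2 h)), abs_of_nonneg (sub_nonneg.2 h)]
  have h1 := add_one_le_exp (v - u)
  calc exp u - exp v = exp u * (1 - exp (v - u)) := by rw [mul_sub, ← exp_add]; ring_nf
    _ ≤ exp u * (u - v) := mul_le_mul_of_nonneg_left (by linarith) (exp_pos u).le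
    _ ≤ exp B * (u - v) := by gcongr

section

variable {n : ℕ} {f : (Fin n → ℝ) → ℝ} {K : NNReal} (hf : LipschitzWith K f) {B : ℝ}
  (hB : ∀ x, |f x| ≤ B)

include hB in
lemma abs_exp_mul_le (s : ℝ) (x : Fin n → ℝ) : |exp (s * f x)| ≤ exp (|s| * B) := by
  rw [abs_of_pos (exp_pos _)]
  refine exp_le_exp.2 ((le_abs_self _).trans ?_)
  rw [abs_mul]
  exact mul_le_mul_of_nonneg_left (hB x) (abs_nonneg s)

include hf hB in
lemma exists_lipschitzWith_exp_mul (s : ℝ) :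
    ∃ K' : NNReal, LipschitzWith K' fun x ↦ exp (s * f x) := by
  refine ⟨⟨exp (|s| * B) * (|s| * K), by positivity⟩, LipschitzWith.of_dist_le_mul fun x y ↦ ?_⟩
  have hle : ∀ x, s * f x ≤ |s| * B := fun x ↦ by
    refine (le_abs_self _).trans ?_
    rw [abs_mul]
    exact mul_le_mul_of_nonneg_left (hB x) (abs_nonneg s)
  have h := hf.dist_le_mul x y
  calc dist (exp (s * f x)) (exp (s * f y)) ≤ exp (|s| * B) * |s * f x - s * f y| :=
        abs_exp_sub_exp_le (hle x) (hle y)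
    _ = exp (|s| * B) * (|s| * dist (f x) (f y)) := by rw [← mul_sub, abs_mul, Real.dist_eq]
    _ ≤ exp (|s| * B) * (|s| * (K * dist x y)) := by gcongr
    _ = exp (|s| * B) * (|s| * K) * dist x y := by ring

include hf in
lemma partialDeriv_exp_mul_ae (s : ℝ) :
    ∀ᵐ x ∂_root_.stdGaussian n, ∀ i,
      partialDeriv (fun x ↦ exp (s * f x)) i x = s * exp (s * f x) * partialDeriv f i x := by
  filter_upwards [ae_differentiableAt_stdGaussian hf] with x hx i
  rw [partialDeriv, ((hx.hasFDerivAt.const_mul s).exp).fderiv, partialDeriv]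
  simp
  ring

include hf hB in
lemma energy_exp_mul_le {b : ℝ} (h2 : ∀ x y, |f x - f y| ≤ b * euclNorm (x - y)) (s : ℝ) :
    energy (fun x ↦ exp (s * f x)) ≤
      s ^ 2 * b ^ 2 * ∫ x, exp (s * f x) ^ 2 ∂_root_.stdGaussian n := by
  have hm : Measurable fun x ↦ exp (s * f x) := by
    have := hf.continuous.measurable
    fun_prop
  obtain ⟨K', hK'⟩ := exists_lipschitzWith_exp_mul hf hB s
  rw [energy, ← integral_const_mul]
  refine integral_mono_ae (integrable_sum_sq_partialDeriv hK')
    ((integrable_pow_of_bound 2 hm (abs_exp_mul_le hB s)).const_mul _) ?_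
  filter_upwards [partialDeriv_exp_mul_ae hf s] with x hx
  simp_rw [hx, mul_pow, ← Finset.mul_sum]
  nlinarith [mul_le_mul_of_nonneg_left (sum_sq_partialDeriv_le h2 x)
    (by positivity : 0 ≤ s ^ 2 * exp (s * f x) ^ 2)]

include hf hB in
lemma sq_integral_abs_partialDeriv_exp_mul_le {A : ℝ} (i : Fin n)
    (hA : ∫ x, |partialDeriv f i x| ∂_root_.stdGaussian n ≤ A) (s : ℝ) :
    (∫ x, |partialDeriv (fun x ↦ exp (s * f x)) i x| ∂_root_.stdGaussian n) ^ 2 ≤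
      s ^ 2 * A * ∫ x, |partialDeriv f i x| * exp (s * f x) ^ 2 ∂_root_.stdGaussian n := by
  have hfm := hf.continuous.measurable
  have hm : Measurable fun x ↦ exp (s * f x) := by fun_prop
  have hd := measurable_partialDeriv f i
  have hb : ∀ x, |√(|partialDeriv f i x|)| ≤ √K := fun x ↦ by
    rw [abs_of_nonneg (Real.sqrt_nonneg _)]
    exact Real.sqrt_le_sqrt (abs_partialDeriv_le hf i x)
  have hsm : Measurable fun x ↦ √(|partialDeriv f i x|) := hd.abs.sqrt
  have h := sq_integral_mul_le_of_bound (_root_.stdGaussian n) hsm (hsm.mul hm) hb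
    (fun x ↦ abs_mul_le_of_bound (hb x) (abs_exp_mul_le hB s x))
  have e : ∫ x, |partialDeriv (fun x ↦ exp (s * f x)) i x| ∂_root_.stdGaussian n =
      |s| * ∫ x, √(|partialDeriv f i x|) * (√(|partialDeriv f i x|) * exp (s * f x))
        ∂_root_.stdGaussian n := by
    rw [← integral_const_mul]
    refine integral_congr_ae ?_
    filter_upwards [partialDeriv_exp_mul_ae hf s] with x hx
    rw [hx, abs_mul, abs_mul, abs_of_pos (exp_pos _), ← mul_assoc (√_),
      Real.mul_self_sqrt (abs_nonneg _)]
    ring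
  simp only [Pi.mul_apply, mul_pow, fun x ↦ Real.sq_sqrt (abs_nonneg (partialDeriv f i x))] at h
  rw [e, mul_pow, sq_abs, mul_assoc]
  refine mul_le_mul_of_nonneg_left (h.trans ?_) (sq_nonneg s)
  exact mul_le_mul_of_nonneg_right hA (integral_nonneg fun x ↦ by positivity)

include hf hB in
lemma sum_sq_influence_exp_mul_le {a A : ℝ} (ha : 0 ≤ a) (hA0 : 0 ≤ A)
    (h1 : ∀ x y, |f x - f y| ≤ a * ‖x - y‖)
    (hA : ∀ i, ∫ x, |partialDeriv f i x| ∂_root_.stdGaussian n ≤ A) (s : ℝ) :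
    ∑ i, influence (fun x ↦ exp (s * f x)) i ^ 2 ≤
      π ^ 2 / 4 * s ^ 2 * (a * A) * ∫ x, exp (s * f x) ^ 2 ∂_root_.stdGaussian n := by
  have hfm := hf.continuous.measurable
  have hm : Measurable fun x ↦ exp (s * f x) := by fun_prop
  obtain ⟨K', hK'⟩ := exists_lipschitzWith_exp_mul hf hB s
  have hi2 := integrable_pow_of_bound (μ := _root_.stdGaussian n) 2 hm (abs_exp_mul_le hB s)
  have hi : ∀ i, Integrable (fun x ↦ |partialDeriv f i x| * exp (s * f x) ^ 2)
      (_root_.stdGaussian n) := fun i ↦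
    hi2.bdd_mul (measurable_partialDeriv f i).abs.aestronglyMeasurable (c := K)
      (Filter.Eventually.of_forall fun x ↦ by
        rw [Real.norm_eq_abs, abs_abs]; exact abs_partialDeriv_le hf i x)
  have hsum : ∑ i, ∫ x, |partialDeriv f i x| * exp (s * f x) ^ 2 ∂_root_.stdGaussian n ≤
      a * ∫ x, exp (s * f x) ^ 2 ∂_root_.stdGaussian n := by
    rw [← integral_finsetSum _ fun i _ ↦ hi i, ← integral_const_mul]
    refine integral_mono (integrable_finsetSum _ fun i _ ↦ hi i) (hi2.const_mul a) fun x ↦ ?_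
    simp only [← Finset.sum_mul]
    exact mul_le_mul_of_nonneg_right (sum_abs_partialDeriv_le ha h1 x) (sq_nonneg _)
  calc ∑ i, influence (fun x ↦ exp (s * f x)) i ^ 2
      ≤ ∑ i, π ^ 2 / 4 * (s ^ 2 * A *
          ∫ x, |partialDeriv f i x| * exp (s * f x) ^ 2 ∂_root_.stdGaussian n) :=
        Finset.sum_le_sum fun i _ ↦ by
          refine (pow_le_pow_left₀ (influence_nonneg _ _)
            (influence_le hK' (abs_exp_mul_le hB s) i) 2).trans ?_
          rw [mul_pow, div_pow]
          norm_num
          exact mul_le_mul_of_nonneg_left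
            (sq_integral_abs_partialDeriv_exp_mul_le hf hB i (hA i) s) (by positivity)
    _ = π ^ 2 / 4 * (s ^ 2 * A) *
          ∑ i, ∫ x, |partialDeriv f i x| * exp (s * f x) ^ 2 ∂_root_.stdGaussian n := by
        rw [Finset.mul_sum]; simp_rw [mul_assoc]
    _ ≤ π ^ 2 / 4 * (s ^ 2 * A) * (a * ∫ x, exp (s * f x) ^ 2 ∂_root_.stdGaussian n) := by
        gcongr
    _ = _ := by ring

end

lemma pi_sq_lt_ten : π ^ 2 < 10 := by nlinarith [pi_lt_d2, pi_pos]

lemma mul_le_of_interpolation {L V D S u l : ℝ} (hL : 0 ≤ L) (hV : 0 ≤ V) (hD : 0 ≤ D)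
    (hS0 : 0 ≤ S) (hS : S ≤ π ^ 2 / 4 * (D * exp (-u))) (hP : V ≤ π ^ 2 / 4 * D)
    (hk : ∀ k : ℕ, V ≤ π ^ 2 / 4 * L * (1 / 2) ^ k * D +
      V ^ (1 - (1 / 2 : ℝ) ^ k / 4) * S ^ ((1 / 2 : ℝ) ^ k / 4))
    (hl : l ≤ max u 1 + 1) : V * l ≤ (18 + 170 * L) * D := by
  have hpi := pi_sq_lt_ten
  have hLD : 0 ≤ L * D := mul_nonneg hL hD
  rcases lt_or_ge u 6 with hu | hu
  · have hl7 : l ≤ 7 := hl.trans (by linarith [max_le hu.le (by norm_num : (1 : ℝ) ≤ 6)])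
    nlinarith [mul_le_mul_of_nonneg_left hl7 hV, mul_le_mul_of_nonneg_right hpi.le hD]
  rw [max_eq_left (by linarith)] at hl
  rcases le_or_gt V (D * exp (-(u / 2))) with hc | hc
  · have h1 : exp (-(u / 2)) * (u / 2 + 1) ≤ 1 := by
      have := mul_le_mul_of_nonneg_left (add_one_le_exp (u / 2)) (exp_pos (-(u / 2))).le
      rwa [← exp_add, neg_add_cancel, exp_zero] at this
    calc V * l ≤ V * (2 * (u / 2 + 1)) := by gcongr; linarith
      _ ≤ (D * exp (-(u / 2))) * (2 * (u / 2 + 1)) := by gcongr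
      _ = 2 * D * (exp (-(u / 2)) * (u / 2 + 1)) := by ring
      _ ≤ 2 * D * 1 := by gcongr
      _ ≤ (18 + 170 * L) * D := by nlinarith
  · have hV0 : 0 < V := (by positivity : 0 ≤ D * exp (-(u / 2))).trans_lt hc
    obtain ⟨k, hk1, hk2⟩ : ∃ k : ℕ, (2 : ℝ) ^ k ≤ u ∧ u < 2 ^ (k + 1) :=
      exists_nat_pow_near (by linarith) (by norm_num)
    have hkk := hk k
    have hinv : (1 / 2 : ℝ) ^ k * 2 ^ k = 1 := by rw [← mul_pow]; norm_num
    set e := (1 / 2 : ℝ) ^ k with he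
    have he0 : 0 < e := by positivity
    have heu1 : 1 ≤ e * u := by rw [← hinv]; gcongr
    have heu2 : e * u ≤ 2 := by
      calc e * u ≤ e * 2 ^ (k + 1) := by gcongr
        _ = 2 := by rw [pow_succ, ← mul_assoc, hinv, one_mul]
    have hSV : S / V ≤ exp (-(u / 4)) := by
      rw [div_le_iff₀ hV0]
      have h25 : π ^ 2 / 4 ≤ exp (u / 4) := by linarith [add_one_le_exp (u / 4)]
      calc S ≤ π ^ 2 / 4 * (D * exp (-u)) := hS
        _ ≤ exp (u / 4) * (D * exp (-u)) := by gcongr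
        _ = exp (-(u / 4)) * (D * exp (-(u / 2))) := by
          rw [mul_left_comm, ← exp_add, mul_left_comm (exp (-(u / 4))), ← exp_add]
          ring_nf
        _ ≤ exp (-(u / 4)) * V := by gcongr
    have hint : V ^ (1 - e / 4) * S ^ (e / 4) ≤ V * (16 / 17) := by
      have h1 : V ^ (1 - e / 4) * S ^ (e / 4) = V * (S / V) ^ (e / 4) := by
        rw [Real.rpow_sub hV0, Real.rpow_one, Real.div_rpow hS0 hV]
        ring
      rw [h1]
      gcongr
      calc (S / V) ^ (e / 4) ≤ exp (-(u / 4)) ^ (e / 4) := by gcongr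
        _ = exp (-(e * u / 16)) := by rw [← exp_mul]; ring_nf
        _ ≤ exp (-(1 / 16)) := by gcongr
        _ ≤ 16 / 17 := by
          rw [exp_neg, inv_le_comm₀ (exp_pos _) (by norm_num)]
          linarith [add_one_le_exp (1 / 16 : ℝ)]
    have hV17 : V ≤ 17 * (π ^ 2 / 4 * L * e * D) := by linarith
    calc V * l ≤ V * (2 * u) := by gcongr; linarith
      _ ≤ 17 * (π ^ 2 / 4 * L * e * D) * (2 * u) := by gcongr
      _ = 17 * (π ^ 2 / 2) * (L * D) * (e * u) := by ring
      _ ≤ 17 * (π ^ 2 / 2) * (L * D) * 2 := by gcongr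
      _ ≤ (18 + 170 * L) * D := by nlinarith

lemma log_exp_one_add_exp_le (u : ℝ) : log (exp 1 + exp u) ≤ max u 1 + 1 := by
  rw [log_le_iff_le_exp (by positivity), exp_add]
  have h1 : exp 1 ≤ exp (max u 1) := exp_le_exp.2 (le_max_right _ _)
  have h2 : exp u ≤ exp (max u 1) := exp_le_exp.2 (le_max_left _ _)
  nlinarith [add_one_le_exp (1 : ℝ), exp_pos (max u 1)]

/-- The variance of `exp (s f)` is superconcentrated. -/
lemma integral_exp_sq_sub_le {r : ℝ} (hr : IsHypercontractive r) {n : ℕ}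
    {f : (Fin n → ℝ) → ℝ} {K : NNReal} (hf : LipschitzWith K f) {B : ℝ} (hB : ∀ x, |f x| ≤ B)
    {a b A : ℝ} (ha : 0 < a) (hb : 0 < b) (hA0 : 0 < A)
    (h2 : ∀ x y, |f x - f y| ≤ b * euclNorm (x - y))
    (h1 : ∀ x y, |f x - f y| ≤ a * ‖x - y‖)
    (hA : ∀ i, ∫ x, |partialDeriv f i x| ∂_root_.stdGaussian n ≤ A) (s : ℝ) :
    (∫ x, exp (s * f x) ^ 2 ∂_root_.stdGaussian n -
        (∫ x, exp (s * f x) ∂_root_.stdGaussian n) ^ 2) * log (exp 1 + b ^ 2 / (a * A)) ≤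
      (18 + 170 * -log r) * (s ^ 2 * b ^ 2 * ∫ x, exp (s * f x) ^ 2 ∂_root_.stdGaussian n) := by
  have hfm := hf.continuous.measurable
  have hm : Measurable fun x ↦ exp (s * f x) := by fun_prop
  have hbd := abs_exp_mul_le hB s
  obtain ⟨K', hK'⟩ := exists_lipschitzWith_exp_mul hf hB s
  have hvar := integral_sq_eq_sq_add (μ := _root_.stdGaussian n) hm hbd
  have hR : 0 < b ^ 2 / (a * A) := by positivity
  set M := ∫ x, exp (s * f x) ^ 2 ∂_root_.stdGaussian n with hM
  have hM0 : 0 ≤ M := integral_nonneg fun _ ↦ sq_nonneg _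
  have hE := energy_exp_mul_le hf hB h2 s
  have hL : 0 ≤ -log r := by linarith [Real.log_nonpos hr.1.le hr.2.1.le]
  have hvl : ∀ k, _ := variance_le_energy_add hr hK' hbd
  set V := ∫ x, (exp (s * f x) - ∫ y, exp (s * f y) ∂_root_.stdGaussian n) ^ 2
    ∂_root_.stdGaussian n with hVdef
  have key := mul_le_of_interpolation (L := -log r) (V := V) (D := s ^ 2 * b ^ 2 * M)
    (S := ∑ i, influence (fun x ↦ exp (s * f x)) i ^ 2) (u := log (b ^ 2 / (a * A)))
    (l := log (exp 1 + b ^ 2 / (a * A))) hL (integral_nonneg fun _ ↦ sq_nonneg _)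
    (by positivity) (Finset.sum_nonneg fun _ _ ↦ sq_nonneg _)
    ((sum_sq_influence_exp_mul_le hf hB ha.le hA0.le h1 hA s).trans_eq ?_)
    ((variance_le_energy hK' hbd).trans (by gcongr)) (fun k ↦ (hvl k).trans (by gcongr)) ?_
  · rwa [show M - (∫ x, exp (s * f x) ∂_root_.stdGaussian n) ^ 2 = V by linarith]
  · rw [exp_neg, exp_log hR, ← hM]
    field_simp
  · have := log_exp_one_add_exp_le (log (b ^ 2 / (a * A)))
    rwa [exp_log hR] at this

lemma lintegral_exp_sum_mul_stdGaussian {n : ℕ} (v : Fin n → ℝ) (s : ℝ) :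
    ∫⁻ y, ENNReal.ofReal (exp (s * ∑ i, v i * y i)) ∂_root_.stdGaussian n =
      ENNReal.ofReal (exp (s ^ 2 * (∑ i, v i ^ 2) / 2)) := by
  have hm : Measurable fun y : Fin n → ℝ ↦ ∑ i, v i * y i := by fun_prop
  rw [← lintegral_map (f := fun t : ℝ ↦ ENNReal.ofReal (exp (s * t))) (by fun_prop) hm,
    map_sum_mul_stdGaussian, ← ofReal_integral_eq_lintegral_ofReal
      (integrable_exp_mul_gaussianReal s)
      (Filter.Eventually.of_forall fun _ ↦ (exp_pos _).le)]
  have h := congrFun (mgf_id_gaussianReal (μ := 0) (v := (∑ i, v i ^ 2).toNNReal)) s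
  simp only [mgf, id] at h
  rw [h, Real.coe_toNNReal _ (Finset.sum_nonneg fun i _ ↦ sq_nonneg _)]
  congr 2
  ring

lemma convexOn_exp_mul (s : ℝ) : ConvexOn ℝ Set.univ fun x ↦ exp (s * x) := by
  exact convexOn_exp.comp_linearMap (LinearMap.mulLeft ℝ s)

lemma exp_integral_le {Ω : Type*} [MeasurableSpace Ω] {μ : Measure Ω} [IsProbabilityMeasure μ]
    {u : Ω → ℝ} (hu : Integrable u μ) (he : Integrable (fun ω ↦ exp (u ω)) μ) :
    exp (∫ ω, u ω ∂μ) ≤ ∫ ω, exp (u ω) ∂μ := by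
  exact convexOn_exp.map_integral_le continuous_exp.continuousOn isClosed_univ
    (Filter.Eventually.of_forall fun _ ↦ Set.mem_univ _) hu he

/-- The Maurey-Pisier exponential bound. -/
lemma integral_exp_le_of_lipschitz {n : ℕ}
    {f : (Fin n → ℝ) → ℝ} {K : NNReal} (hf : LipschitzWith K f) {B : ℝ} (hB : ∀ x, |f x| ≤ B)
    {b : ℝ} (h2 : ∀ x y, |f x - f y| ≤ b * euclNorm (x - y)) (s : ℝ) :
    ∫ x, exp (s * f x) ∂_root_.stdGaussian n ≤
      exp (s * ∫ x, f x ∂_root_.stdGaussian n + π ^ 2 * b ^ 2 / 8 * s ^ 2) := by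
  have hfm := hf.continuous.measurable
  have hi : ∀ s, Integrable (fun x ↦ exp (s * f x)) (_root_.stdGaussian n) := fun s ↦
    integrable_of_bound (by fun_prop) (abs_exp_mul_le hB s)
  have h := lintegral_convex_rotation_le hf (convexOn_exp_mul s) (fun _ ↦ (exp_pos _).le)
    (half_pos pi_pos)
  have hm2 : Measurable fun q : (Fin n → ℝ) × (Fin n → ℝ) ↦ fderiv ℝ f q.1 q.2 :=
    measurable_fderiv_apply f measurable_fst measurable_snd
  have hr : ∫⁻ q : (Fin n → ℝ) × (Fin n → ℝ),
      ENNReal.ofReal (exp (s * (π / 2 * fderiv ℝ f q.1 q.2)))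
      ∂((_root_.stdGaussian n).prod (_root_.stdGaussian n)) ≤
      ENNReal.ofReal (exp (π ^ 2 * b ^ 2 / 8 * s ^ 2)) := by
    rw [lintegral_prod _ (by fun_prop)]
    have hx : ∀ x, ∫⁻ y, ENNReal.ofReal (exp (s * (π / 2 * fderiv ℝ f x y)))
        ∂_root_.stdGaussian n ≤ ENNReal.ofReal (exp (π ^ 2 * b ^ 2 / 8 * s ^ 2)) := by
      intro x
      simp_rw [fderiv_apply_eq_sum, ← mul_assoc s]
      rw [lintegral_exp_sum_mul_stdGaussian]
      refine ENNReal.ofReal_le_ofReal (exp_le_exp.2 ?_)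
      have := mul_le_mul_of_nonneg_left (sum_sq_partialDeriv_le h2 x)
        (by positivity : 0 ≤ (s * (π / 2)) ^ 2 / 2)
      linarith
    exact (lintegral_mono hx).trans_eq (by simp)
  have hl : ∫⁻ q : (Fin n → ℝ) × (Fin n → ℝ),
      ENNReal.ofReal (exp (s * (f (cos (π / 2) • q.1 + sin (π / 2) • q.2) - f q.1)))
      ∂((_root_.stdGaussian n).prod (_root_.stdGaussian n)) =
      ENNReal.ofReal ((∫ x, exp (-s * f x) ∂_root_.stdGaussian n) *
        ∫ x, exp (s * f x) ∂_root_.stdGaussian n) := by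
    rw [ENNReal.ofReal_mul (integral_nonneg fun _ ↦ (exp_pos _).le),
      ofReal_integral_eq_lintegral_ofReal (hi _)
        (Filter.Eventually.of_forall fun _ ↦ (exp_pos _).le),
      ofReal_integral_eq_lintegral_ofReal (hi _)
        (Filter.Eventually.of_forall fun _ ↦ (exp_pos _).le),
      ← lintegral_prod_mul (by fun_prop) (by fun_prop)]
    refine lintegral_congr fun q ↦ ?_
    rw [← ENNReal.ofReal_mul (exp_pos _).le, ← exp_add]
    simp
    ring_nf
  have hle := (ENNReal.ofReal_le_ofReal_iff (exp_pos _).le).1 ((hl.symm.le.trans h).trans hr)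
  have hfi : Integrable f (_root_.stdGaussian n) := integrable_of_bound hfm hB
  have hj := exp_integral_le (hfi.const_mul (-s)) (hi (-s))
  rw [integral_const_mul] at hj
  rw [exp_add]
  set m := ∫ x, f x ∂_root_.stdGaussian n
  have h3 : exp (-s * m) * ∫ x, exp (s * f x) ∂_root_.stdGaussian n ≤
      exp (π ^ 2 * b ^ 2 / 8 * s ^ 2) :=
    (mul_le_mul_of_nonneg_right hj (integral_nonneg fun _ ↦ (exp_pos _).le)).trans hle
  calc ∫ x, exp (s * f x) ∂_root_.stdGaussian n
      = exp (s * m) * (exp (-s * m) * ∫ x, exp (s * f x) ∂_root_.stdGaussian n) := by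
        rw [← mul_assoc, ← exp_add]; simp
    _ ≤ exp (s * m) * exp (π ^ 2 * b ^ 2 / 8 * s ^ 2) := by gcongr

lemma le_exp_of_halving {M : ℝ → ℝ} (hM : ∀ s, 0 ≤ M s) {m c q : ℝ} (hq : 0 ≤ q)
    (h0 : ∀ s, M s ≤ exp (s * m + c * s ^ 2))
    (h : ∀ s, M s * (1 - q * s ^ 2) ≤ M (s / 2) ^ 2) {s : ℝ} (hs : q * s ^ 2 ≤ 1 / 2) :
    M s ≤ exp (s * m + 4 * q * s ^ 2) := by
  have hk : ∀ k : ℕ, ∀ s : ℝ, q * s ^ 2 ≤ 1 / 2 →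
      M s ≤ exp (s * m + 4 * q * s ^ 2 + c * s ^ 2 * (1 / 2) ^ k) := by
    intro k
    induction k with
    | zero =>
      intro s _
      refine (h0 s).trans (exp_le_exp.2 ?_)
      nlinarith [mul_nonneg hq (sq_nonneg s)]
    | succ k ih =>
      intro s hs
      have hqs := mul_nonneg hq (sq_nonneg s)
      have h1 := ih (s / 2) (by nlinarith)
      have h2 : 1 ≤ exp (2 * (q * s ^ 2)) * (1 - q * s ^ 2) := by
        nlinarith [add_one_le_exp (2 * (q * s ^ 2))]
      calc M s ≤ M s * (exp (2 * (q * s ^ 2)) * (1 - q * s ^ 2)) :=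
            le_mul_of_one_le_right (hM s) h2
        _ = exp (2 * (q * s ^ 2)) * (M s * (1 - q * s ^ 2)) := by ring
        _ ≤ exp (2 * (q * s ^ 2)) * M (s / 2) ^ 2 := by gcongr; exact h s
        _ ≤ exp (2 * (q * s ^ 2)) * exp (s / 2 * m + 4 * q * (s / 2) ^ 2 +
              c * (s / 2) ^ 2 * (1 / 2) ^ k) ^ 2 := by
            gcongr
            exact hM _
        _ = _ := by
            rw [← exp_nat_mul, ← exp_add]
            congr 1
            rw [pow_succ]
            push_cast
            ring
  have hlim : Filter.Tendsto (fun k : ℕ ↦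
      exp (s * m + 4 * q * s ^ 2 + c * s ^ 2 * (1 / 2) ^ k)) Filter.atTop
      (nhds (exp (s * m + 4 * q * s ^ 2 + c * s ^ 2 * 0))) :=
    (continuous_exp.tendsto _).comp (((tendsto_pow_atTop_nhds_zero_of_lt_one (by norm_num)
      (by norm_num)).const_mul _).const_add _)
  rw [mul_zero, add_zero] at hlim
  exact ge_of_tendsto' hlim fun k ↦ hk k s hs

/-- The improved exponential bound, for bounded functions. -/
lemma integral_exp_le_of_isHypercontractive {r : ℝ} (hr : IsHypercontractive r) {n : ℕ}
    {f : (Fin n → ℝ) → ℝ} {K : NNReal} (hf : LipschitzWith K f) {B : ℝ} (hB : ∀ x, |f x| ≤ B)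
    {a b A : ℝ} (ha : 0 < a) (hb : 0 < b) (hA0 : 0 < A)
    (h2 : ∀ x y, |f x - f y| ≤ b * euclNorm (x - y))
    (h1 : ∀ x y, |f x - f y| ≤ a * ‖x - y‖)
    (hA : ∀ i, ∫ x, |partialDeriv f i x| ∂_root_.stdGaussian n ≤ A) {q : ℝ}
    (hq : q = (18 + 170 * -log r) * b ^ 2 / (4 * log (exp 1 + b ^ 2 / (a * A)))) {s : ℝ}
    (hs : q * s ^ 2 ≤ 1 / 2) :
    ∫ x, exp (s * f x) ∂_root_.stdGaussian n ≤
      exp (s * ∫ x, f x ∂_root_.stdGaussian n + 4 * q * s ^ 2) := by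
  have hl : 0 < log (exp 1 + b ^ 2 / (a * A)) :=
    log_pos (by linarith [add_one_lt_exp (one_ne_zero (α := ℝ)),
      (by positivity : 0 < b ^ 2 / (a * A))])
  have hL : 0 ≤ -log r := by linarith [Real.log_nonpos hr.1.le hr.2.1.le]
  refine le_exp_of_halving (M := fun s ↦ ∫ x, exp (s * f x) ∂_root_.stdGaussian n)
    (fun s ↦ integral_nonneg fun _ ↦ (exp_pos _).le) (by rw [hq]; positivity)
    (fun s ↦ integral_exp_le_of_lipschitz hf hB h2 s) (fun s ↦ ?_) hs
  have h := integral_exp_sq_sub_le hr hf hB ha hb hA0 h2 h1 hA (s / 2)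
  have hsq : ∀ x, exp (s / 2 * f x) ^ 2 = exp (s * f x) := fun x ↦ by
    rw [← exp_nat_mul]; congr 1; push_cast; ring
  simp only [hsq] at h
  have hql : q * s ^ 2 * log (exp 1 + b ^ 2 / (a * A)) =
      (18 + 170 * -log r) * ((s / 2) ^ 2 * b ^ 2) := by
    rw [hq]
    generalize log (exp 1 + b ^ 2 / (a * A)) = l at hl ⊢
    field_simp
    ring
  refine le_of_mul_le_mul_right ?_ hl
  linear_combination h + (-∫ x, exp (s * f x) ∂_root_.stdGaussian n) * hql

/-- Truncation of `u` to the interval `[-N, N]`. -/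
noncomputable def truncate (N u : ℝ) : ℝ := max (-N) (min u N)

lemma abs_truncate_sub_le (N u v : ℝ) : |truncate N u - truncate N v| ≤ |u - v| := by
  have h1 : |truncate N u - truncate N v| ≤ |min u N - min v N| := by
    rw [truncate, truncate, max_comm _ (min u N), max_comm _ (min v N)]
    exact abs_max_sub_max_le_abs _ _ _
  refine h1.trans ((abs_min_sub_min_le_max u N v N).trans ?_)
  simp

lemma abs_truncate_le {N : ℝ} (hN : 0 ≤ N) (u : ℝ) : |truncate N u| ≤ N :=
  abs_le.2 ⟨le_max_left _ _, max_le (by linarith) (min_le_right _ _)⟩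

lemma abs_truncate_le_abs {N : ℝ} (hN : 0 ≤ N) (u : ℝ) : |truncate N u| ≤ |u| := by
  have h := abs_truncate_sub_le N u 0
  have h0 : truncate N 0 = 0 := by simp [truncate, hN]
  simpa [h0] using h

lemma truncate_eq_self {N u : ℝ} (h : |u| ≤ N) : truncate N u = u := by
  rw [truncate, min_eq_left (abs_le.1 h).2, max_eq_right (abs_le.1 h).1]

lemma tendsto_truncate (u : ℝ) :
    Filter.Tendsto (fun N : ℕ ↦ truncate N u) Filter.atTop (nhds u) := by
  refine tendsto_const_nhds.congr' ?_
  filter_upwards [Filter.eventually_ge_atTop ⌈|u|⌉₊] with N hN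
  exact (truncate_eq_self (Nat.ceil_le.1 hN)).symm

lemma abs_partialDeriv_le_of_abs_sub_le {n : ℕ} {f g : (Fin n → ℝ) → ℝ}
    (h : ∀ x y, |g x - g y| ≤ |f x - f y|) {x : Fin n → ℝ} (hf : DifferentiableAt ℝ f x)
    (i : Fin n) : |partialDeriv g i x| ≤ |partialDeriv f i x| := by
  by_cases hg : DifferentiableAt ℝ g x
  · have hline : HasDerivAt (fun t : ℝ ↦ x + t • (Pi.single i 1 : Fin n → ℝ))
        (Pi.single i 1) 0 := by
      simpa using ((hasDerivAt_id (0 : ℝ)).smul_const (Pi.single i 1 : Fin n → ℝ)).const_add x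
    have hf' : HasFDerivAt f (fderiv ℝ f x) (x + (0 : ℝ) • (Pi.single i 1 : Fin n → ℝ)) := by
      simpa using hf.hasFDerivAt
    have hg' : HasFDerivAt g (fderiv ℝ g x) (x + (0 : ℝ) • (Pi.single i 1 : Fin n → ℝ)) := by
      simpa using hg.hasFDerivAt
    have tf := hasDerivAt_iff_tendsto_slope.1 (hf'.comp_hasDerivAt (0 : ℝ) hline)
    have tg := hasDerivAt_iff_tendsto_slope.1 (hg'.comp_hasDerivAt (0 : ℝ) hline)
    refine le_of_tendsto_of_tendsto' tg.abs tf.abs fun t ↦ ?_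
    simp only [slope, vsub_eq_sub, smul_eq_mul, abs_mul, Function.comp_apply]
    exact mul_le_mul_of_nonneg_left (h _ _) (abs_nonneg _)
  · rw [partialDeriv, fderiv_zero_of_not_differentiableAt hg]
    simp

lemma measure_lt_abs_le {Ω : Type*} [MeasurableSpace Ω] {μ : Measure Ω} {u : Ω → ℝ}
    (hu : Measurable u) {s t D : ℝ} (hs : 0 ≤ s)
    (h1 : ∫⁻ ω, ENNReal.ofReal (exp (s * u ω)) ∂μ ≤ ENNReal.ofReal (exp D))
    (h2 : ∫⁻ ω, ENNReal.ofReal (exp (-s * u ω)) ∂μ ≤ ENNReal.ofReal (exp D)) :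
    μ {ω | t < |u ω|} ≤ ENNReal.ofReal (2 * exp (D - s * t)) := by
  have key : ∀ v : Ω → ℝ, Measurable v →
      ∫⁻ ω, ENNReal.ofReal (exp (s * v ω)) ∂μ ≤ ENNReal.ofReal (exp D) →
      μ {ω | t < v ω} ≤ ENNReal.ofReal (exp (D - s * t)) := by
    intro v hv h
    have hsub : {ω | t < v ω} ⊆
        {ω | ENNReal.ofReal (exp (s * t)) ≤ ENNReal.ofReal (exp (s * v ω))} := fun ω hω ↦
      ENNReal.ofReal_le_ofReal (exp_le_exp.2 (mul_le_mul_of_nonneg_left (le_of_lt hω) hs))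
    rw [exp_sub, ENNReal.ofReal_div_of_pos (exp_pos _)]
    refine (measure_mono hsub).trans ((meas_ge_le_lintegral_div (by fun_prop) ?_
      ENNReal.ofReal_ne_top).trans (ENNReal.div_le_div_right h _))
    simpa using exp_pos (s * t)
  have hsub : {ω | t < |u ω|} ⊆ {ω | t < u ω} ∪ {ω | t < -u ω} := fun ω hω ↦ by
    simpa [lt_abs] using hω
  refine (measure_mono hsub).trans ((measure_union_le _ _).trans ?_)
  rw [two_mul, ENNReal.ofReal_add (exp_pos _).le (exp_pos _).le]
  exact add_le_add (key u hu h1) (key (fun ω ↦ -u ω) hu.neg (by simpa using h2))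

section

variable {n : ℕ} {f : (Fin n → ℝ) → ℝ} {K : NNReal} (hf : LipschitzWith K f)

include hf in
lemma integrable_of_lipschitzWith : Integrable f (_root_.stdGaussian n) := by
  have hid : Integrable (fun x ↦ x) (_root_.stdGaussian n) := IsGaussian.integrable_id
  refine ((integrable_const |f 0|).add (hid.norm.const_mul K)).mono'
    hf.continuous.aestronglyMeasurable (Filter.Eventually.of_forall fun x ↦ ?_)
  have h := hf.dist_le_mul x 0
  rw [Real.dist_eq, dist_zero_right] at h
  have h2 := abs_add_le (f x - f 0) (f 0)
  rw [sub_add_cancel] at h2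
  simp only [Pi.add_apply, Real.norm_eq_abs]
  linarith

include hf in
/-- Exponential bounds pass from the truncations of a function to the function itself. -/
lemma lintegral_exp_sub_le_of_truncate {s D : ℝ}
    (h : ∀ N : ℕ, ∫ x, exp (s * truncate N (f x)) ∂_root_.stdGaussian n ≤
      exp (s * ∫ x, truncate N (f x) ∂_root_.stdGaussian n + D)) :
    ∫⁻ x, ENNReal.ofReal (exp (s * (f x - ∫ y, f y ∂_root_.stdGaussian n)))
      ∂_root_.stdGaussian n ≤ ENNReal.ofReal (exp D) := by
  have hfm := hf.continuous.measurable
  have htm : ∀ N : ℕ, Measurable fun x ↦ truncate N (f x) := fun N ↦ by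
    unfold truncate; fun_prop
  have hm : Filter.Tendsto (fun N : ℕ ↦ ∫ x, truncate N (f x) ∂_root_.stdGaussian n)
      Filter.atTop (nhds (∫ y, f y ∂_root_.stdGaussian n)) :=
    tendsto_integral_of_dominated_convergence (fun x ↦ |f x|)
      (fun N ↦ (htm N).aestronglyMeasurable) (integrable_of_lipschitzWith hf).abs
      (fun N ↦ Filter.Eventually.of_forall fun x ↦ abs_truncate_le_abs N.cast_nonneg _)
      (Filter.Eventually.of_forall fun x ↦ tendsto_truncate _)
  have hlim : ∀ x, Filter.Tendsto (fun N : ℕ ↦ ENNReal.ofReal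
      (exp (s * (truncate N (f x) - ∫ y, truncate N (f y) ∂_root_.stdGaussian n)))) Filter.atTop
      (nhds (ENNReal.ofReal (exp (s * (f x - ∫ y, f y ∂_root_.stdGaussian n))))) := fun x ↦
    ENNReal.tendsto_ofReal ((continuous_exp.tendsto _).comp
      (((tendsto_truncate (f x)).sub hm).const_mul s))
  simp_rw [← fun x ↦ (hlim x).liminf_eq]
  refine (lintegral_liminf_le fun N ↦ ?_).trans ?_
  · have := htm N
    fun_prop
  refine (Filter.liminf_le_liminf (Filter.Eventually.of_forall fun N ↦ ?_)).trans_eq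
    (Filter.liminf_const _)
  have hb : ∀ x, |truncate N (f x)| ≤ N := fun x ↦ abs_truncate_le N.cast_nonneg _
  have hi : Integrable (fun x ↦ exp (s * truncate N (f x))) (_root_.stdGaussian n) :=
    integrable_of_bound (by have := htm N; fun_prop) (abs_exp_mul_le hb s)
  have hrw : ∀ x, exp (s * (truncate N (f x) - ∫ y, truncate N (f y) ∂_root_.stdGaussian n)) =
      exp (-(s * ∫ y, truncate N (f y) ∂_root_.stdGaussian n)) * exp (s * truncate N (f x)) :=
    fun x ↦ by rw [← exp_add]; ring_nf
  simp_rw [hrw]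
  rw [← ofReal_integral_eq_lintegral_ofReal (hi.const_mul _)
    (Filter.Eventually.of_forall fun _ ↦ by positivity), integral_const_mul]
  refine ENNReal.ofReal_le_ofReal ((mul_le_mul_of_nonneg_left (h N) (exp_pos _).le).trans_eq ?_)
  rw [← exp_add]
  ring_nf

end

section

variable {n : ℕ} {f : (Fin n → ℝ) → ℝ} {K : NNReal} (hf : LipschitzWith K f)

include hf in
lemma measure_deviation_le_of_truncate {s D : ℝ} (hs : 0 ≤ s)
    (h : ∀ s' : ℝ, s' ^ 2 = s ^ 2 → ∀ N : ℕ,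
      ∫ x, exp (s' * truncate N (f x)) ∂_root_.stdGaussian n ≤
        exp (s' * ∫ x, truncate N (f x) ∂_root_.stdGaussian n + D)) (t : ℝ) :
    _root_.stdGaussian n {x | t < |f x - ∫ y, f y ∂_root_.stdGaussian n|} ≤
      ENNReal.ofReal (2 * exp (D - s * t)) :=
  measure_lt_abs_le (hf.continuous.measurable.sub_const _) hs
    (lintegral_exp_sub_le_of_truncate hf (h s rfl))
    (lintegral_exp_sub_le_of_truncate hf (h (-s) (neg_sq s)))

lemma lipschitzWith_truncate_comp {f : (Fin n → ℝ) → ℝ} (hf : LipschitzWith K f) (N : ℝ) :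
    LipschitzWith K fun x ↦ truncate N (f x) :=
  LipschitzWith.of_dist_le_mul fun x y ↦
    (abs_truncate_sub_le N (f x) (f y)).trans (hf.dist_le_mul x y)

include hf in
lemma integral_abs_partialDeriv_truncate_le (N : ℝ) (i : Fin n) :
    ∫ x, |partialDeriv (fun x ↦ truncate N (f x)) i x| ∂_root_.stdGaussian n ≤
      ∫ x, |partialDeriv f i x| ∂_root_.stdGaussian n := by
  have hi : ∀ {g : (Fin n → ℝ) → ℝ}, LipschitzWith K g →
      Integrable (fun x ↦ |partialDeriv g i x|) (_root_.stdGaussian n) := fun {g} hg ↦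
    (integrable_of_bound (measurable_partialDeriv g i) (abs_partialDeriv_le hg i)).abs
  refine integral_mono_ae (hi (lipschitzWith_truncate_comp hf N)) (hi hf) ?_
  filter_upwards [ae_differentiableAt_stdGaussian hf] with x hx
  exact abs_partialDeriv_le_of_abs_sub_le (fun _ _ ↦ abs_truncate_sub_le _ _ _) hx i

include hf in
lemma measure_deviation_le_of_lipschitz {b : ℝ} (hb : 0 < b)
    (h2 : ∀ x y, |f x - f y| ≤ b * euclNorm (x - y)) {t : ℝ} (ht : 0 ≤ t) :
    _root_.stdGaussian n {x | t < |f x - ∫ y, f y ∂_root_.stdGaussian n|} ≤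
      ENNReal.ofReal (2 * exp (-(1 / 5) * (t ^ 2 / b ^ 2))) := by
  have hπ := pi_pos
  refine (measure_deviation_le_of_truncate hf (s := 4 * t / (π ^ 2 * b ^ 2))
    (D := π ^ 2 * b ^ 2 / 8 * (4 * t / (π ^ 2 * b ^ 2)) ^ 2) (by positivity)
    (fun s' hs' N ↦ hs' ▸ integral_exp_le_of_lipschitz (lipschitzWith_truncate_comp hf N)
      (fun x ↦ abs_truncate_le N.cast_nonneg _)
      (fun x y ↦ (abs_truncate_sub_le _ _ _).trans (h2 x y)) s') t).trans ?_
  gcongr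
  have h1 : π ^ 2 * b ^ 2 / 8 * (4 * t / (π ^ 2 * b ^ 2)) ^ 2 - 4 * t / (π ^ 2 * b ^ 2) * t =
      -(2 / π ^ 2) * (t ^ 2 / b ^ 2) := by
    field_simp
    ring
  rw [h1]
  gcongr ?_ * _
  rw [neg_le_neg_iff, div_le_div_iff₀ (by norm_num) (by positivity)]
  linarith [pi_sq_lt_ten]

include hf in
lemma measure_deviation_le_of_isHypercontractive {r : ℝ} (hr : IsHypercontractive r)
    {a b A : ℝ} (ha : 0 < a) (hb : 0 < b) (hA0 : 0 < A)
    (h2 : ∀ x y, |f x - f y| ≤ b * euclNorm (x - y))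
    (h1 : ∀ x y, |f x - f y| ≤ a * ‖x - y‖)
    (hA : ∀ i, ∫ x, |partialDeriv f i x| ∂_root_.stdGaussian n ≤ A) (t : ℝ) :
    _root_.stdGaussian n {x | t < |f x - ∫ y, f y ∂_root_.stdGaussian n|} ≤
      ENNReal.ofReal (4 * exp (-(1 / √(2 * (18 + 170 * -log r))) *
        (t / b * √(log (exp 1 + b ^ 2 / (a * A)))))) := by
  set l := log (exp 1 + b ^ 2 / (a * A)) with hl
  set k := 18 + 170 * -log r with hk
  have hl0 : 0 < l := log_pos (by
    linarith [add_one_lt_exp (one_ne_zero (α := ℝ)), (by positivity : 0 < b ^ 2 / (a * A))])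
  have hk0 : 0 < k := by linarith [log_neg hr.1 hr.2.1]
  have hs : (√l / (b * √(2 * k))) ^ 2 = l / (b ^ 2 * (2 * k)) := by
    rw [div_pow, mul_pow, sq_sqrt hl0.le, sq_sqrt (by positivity)]
  have hqs : k * b ^ 2 / (4 * l) * (√l / (b * √(2 * k))) ^ 2 = 1 / 8 := by
    rw [hs]
    field_simp
    norm_num
  refine (measure_deviation_le_of_truncate hf (s := √l / (b * √(2 * k))) (D := 1 / 2)
    (by positivity) (fun s' hs' N ↦ ?_) t).trans ?_
  · rw [← hs'] at hqs
    refine (integral_exp_le_of_isHypercontractive hr (lipschitzWith_truncate_comp hf N)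
      (fun x ↦ abs_truncate_le N.cast_nonneg _) ha hb hA0
      (fun x y ↦ (abs_truncate_sub_le _ _ _).trans (h2 x y))
      (fun x y ↦ (abs_truncate_sub_le _ _ _).trans (h1 x y))
      (fun i ↦ (integral_abs_partialDeriv_truncate_le hf N i).trans (hA i)) rfl
      (hqs.trans_le (by norm_num))).trans_eq ?_
    rw [mul_assoc 4, hqs]
    norm_num
  · have he : exp (1 / 2) ≤ 2 := by
      have h := exp_one_lt_d9
      have h' : exp (1 / 2) ^ 2 = exp 1 := by rw [← exp_nat_mul]; norm_num
      nlinarith [exp_pos (1 / 2)]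
    refine ENNReal.ofReal_le_ofReal ?_
    have h' : -(1 / √(2 * k)) * (t / b * √l) = -(√l / (b * √(2 * k)) * t) := by
      field_simp
    rw [h', sub_eq_add_neg, exp_add]
    nlinarith [exp_pos (-(√l / (b * √(2 * k)) * t))]

end

end GaussianDeviation

/-- Two-level deviation inequality: if `f` is `b`-Lipschitz w.r.t. `‖·‖₂`,
`a`-Lipschitz w.r.t. `‖·‖_∞` and `‖∂ᵢ f‖_{L¹(γₙ)} ≤ A` for all `i`, then
`P(|f(G) − E f(G)| > t) ≤ 4 exp(−c max{t²/b², (t/b)√(log(e + b²/(aA)))})`. -/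
theorem statement3 :
    ∃ c > (0 : ℝ), ∀ (n : ℕ) (f : (Fin n → ℝ) → ℝ) (a b A : ℝ),
      0 < a → 0 < b → 0 < A →
      (∀ x y, |f x - f y| ≤ b * euclNorm (x - y)) →
      (∀ x y, |f x - f y| ≤ a * ‖x - y‖) →
      (∀ i : Fin n, ∫ x, |partialDeriv f i x| ∂stdGaussian n ≤ A) →
      ∀ t > (0 : ℝ),
        stdGaussian n {x | t < |f x - ∫ y, f y ∂stdGaussian n|}
          ≤ ENNReal.ofReal
              (4 * Real.exp (-c * max (t ^ 2 / b ^ 2)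
                (t / b * Real.sqrt (Real.log (Real.exp 1 + b ^ 2 / (a * A)))))) := by
  obtain ⟨r, hr⟩ : ∃ r, GaussianDeviation.IsHypercontractive r :=
    GaussianDeviation.exists_lintegral_mul_self_le
  have hk : 0 < 18 + 170 * -log r := by linarith [log_neg hr.1 hr.2.1]
  refine ⟨min (1 / 5) (1 / √(2 * (18 + 170 * -log r))), by positivity, ?_⟩
  intro n f a b A ha hb hA0 h2 h1 hA t ht
  have hf : LipschitzWith ⟨a, ha.le⟩ f := LipschitzWith.of_dist_le_mul fun x y ↦ by
    rw [Real.dist_eq, dist_eq_norm]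
    exact h1 x y
  rcases max_choice (t ^ 2 / b ^ 2) (t / b * √(log (exp 1 + b ^ 2 / (a * A)))) with h | h <;>
    rw [h]
  · refine (GaussianDeviation.measure_deviation_le_of_lipschitz hf hb h2 ht.le).trans ?_
    gcongr
    · norm_num
    · exact min_le_left _ _
  · refine (GaussianDeviation.measure_deviation_le_of_isHypercontractive hf hr ha hb hA0 h2 h1
      hA t).trans ?_
    gcongr
    exact min_le_right _ _
end

section
/- Let ‖·‖ be a 1-unconditional norm on ℝⁿ. Then max{ ‖x‖ : ‖x‖_∞ ≤ 1 } = ‖e₁ + e₂ + ⋯ + eₙ‖, and E‖G‖ ≥ √(2/π) · ‖e₁ + e₂ + ⋯ + eₙ‖, where G is a standard n-dimensional Gaussian vector. In particular, E‖G‖ ≥ √(2/π) · a, where a = max{ ‖x‖ : ‖x‖_∞ ≤ 1 } is the Lipschitz constant of the norm with respect to ‖·‖_∞. -/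
open MeasureTheory ProbabilityTheory Real

theorem integral_abs_gaussianReal : ∫ x, |x| ∂gaussianReal 0 1 = √(2 / π) := by
  have hΓ : ∫ x in Set.Ioi (0 : ℝ), x * exp (-(1 / 2) * x ^ 2) = 1 := by
    have h := integral_rpow_mul_exp_neg_mul_rpow (p := 2) (q := 1) (b := 1 / 2)
      (by norm_num) (by norm_num) (by norm_num)
    norm_num [Real.rpow_neg_one] at h
    norm_num
    exact h
  rw [integral_gaussianReal_eq_integral_smul one_ne_zero]
  have hpdf : ∀ x : ℝ, gaussianPDFReal 0 1 x • |x|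
      = (√(2 * π))⁻¹ * (|x| * exp (-(1 / 2) * |x| ^ 2)) := fun x => by
    rw [gaussianPDFReal, smul_eq_mul, sq_abs]
    simp only [NNReal.coe_one, mul_one, sub_zero]
    rw [show -x ^ 2 / 2 = -(1 / 2) * x ^ 2 by ring]
    ring
  simp_rw [hpdf]
  rw [integral_const_mul, integral_comp_abs (f := fun x => x * exp (-(1 / 2) * x ^ 2)), hΓ,
    Real.sqrt_mul zero_le_two, Real.sqrt_div zero_le_two, mul_one]
  have h2 : √2 * √2 = 2 := Real.mul_self_sqrt zero_le_two
  have hπ : √π ≠ 0 := (Real.sqrt_pos.2 pi_pos).ne'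
  field_simp
  nlinarith

theorem convexOn_univ_of_subadditive_of_abs_homogeneous {E : Type*} [AddCommGroup E] [Module ℝ E]
    {N : E → ℝ} (hadd : ∀ x y, N (x + y) ≤ N x + N y)
    (hsmul : ∀ (r : ℝ) (x), N (r • x) = |r| * N x) : ConvexOn ℝ Set.univ N := by
  refine ⟨convex_univ, fun x _ y _ a b ha hb _ => (hadd _ _).trans_eq ?_⟩
  rw [hsmul, hsmul, abs_of_nonneg ha, abs_of_nonneg hb, smul_eq_mul, smul_eq_mul]

theorem mem_convexHull_signs_of_norm_le_one {ι : Type*} [Fintype ι] {x : ι → ℝ} (hx : ‖x‖ ≤ 1) :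
    x ∈ convexHull ℝ (Set.univ.pi fun _ : ι => ({1, -1} : Set ℝ)) := by
  rw [convexHull_pi]
  intro i _
  rw [convexHull_pair, segment_symm, segment_eq_Icc (by norm_num)]
  exact abs_le.1 ((norm_le_pi_norm x i).trans hx)

section Unconditional

variable {ι : Type*} {N : (ι → ℝ) → ℝ}

theorem unconditional_apply_abs
    (hunc : ∀ ε : ι → ℝ, (∀ i, ε i = 1 ∨ ε i = -1) → ∀ x : ι → ℝ, N (fun i => ε i * x i) = N x)
    (x : ι → ℝ) : N (fun i => |x i|) = N x := by
  rw [← hunc (fun i => if 0 ≤ x i then 1 else -1) (fun i => by split_ifs <;> simp) x]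
  congr 1
  ext i
  split_ifs with h
  · rw [abs_of_nonneg h, one_mul]
  · rw [abs_of_neg (not_le.1 h), neg_one_mul]

theorem unconditional_le_apply_one [Fintype ι] (hconv : ConvexOn ℝ Set.univ N)
    (hunc : ∀ ε : ι → ℝ, (∀ i, ε i = 1 ∨ ε i = -1) → ∀ x : ι → ℝ, N (fun i => ε i * x i) = N x)
    {x : ι → ℝ} (hx : ‖x‖ ≤ 1) : N x ≤ N fun _ => 1 := by
  obtain ⟨ε, hε, hle⟩ := hconv.exists_ge_of_mem_convexHull (Set.subset_univ _)
    (mem_convexHull_signs_of_norm_le_one hx)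
  refine hle.trans_eq ?_
  simpa using hunc ε (fun i => hε i trivial) fun _ => 1

end Unconditional

theorem abs_le_mul_norm_of_le_on_unit_ball {E : Type*} [NormedAddCommGroup E] [NormedSpace ℝ E]
    {N : E → ℝ} {C : ℝ} (hadd : ∀ x y, N (x + y) ≤ N x + N y)
    (hsmul : ∀ (r : ℝ) (x), N (r • x) = |r| * N x) (hC : ∀ x, ‖x‖ ≤ 1 → N x ≤ C) (x : E) :
    |N x| ≤ C * ‖x‖ := by
  have h0 : N 0 = 0 := by simpa using hsmul 0 0
  have hneg : N (-x) = N x := by simpa using hsmul (-1) x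
  have hnonneg : 0 ≤ N x := by
    have h := hadd x (-x)
    rw [add_neg_cancel, h0, hneg] at h
    linarith
  rw [abs_of_nonneg hnonneg]
  rcases eq_or_ne x 0 with rfl | hx
  · simp [h0]
  · have hpos := norm_pos_iff.2 hx
    have h := hC (‖x‖⁻¹ • x) (by simp [norm_smul, hpos.ne'])
    rw [hsmul, abs_of_pos (inv_pos.2 hpos), inv_mul_le_iff₀ hpos] at h
    linarith

/-- For a 1-unconditional norm `N` on `ℝⁿ`:
`max{ N x : ‖x‖_∞ ≤ 1 } = N(e₁ + ⋯ + eₙ)` and `E N(G) ≥ √(2/π) · N(e₁ + ⋯ + eₙ)`,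
hence `E N(G) ≥ √(2/π) · a` where `a` is the `‖·‖_∞`-Lipschitz constant of `N`. -/
theorem statement4 (n : ℕ) (N : (Fin n → ℝ) → ℝ)
    (hadd : ∀ x y, N (x + y) ≤ N x + N y)
    (hsmul : ∀ (r : ℝ) (x), N (r • x) = |r| * N x)
    (hdef : ∀ x, N x = 0 → x = 0)
    (hunc : ∀ ε : Fin n → ℝ, (∀ i, ε i = 1 ∨ ε i = -1) →
      ∀ x : Fin n → ℝ, N (fun i => ε i * x i) = N x) :
    IsGreatest {s | ∃ x : Fin n → ℝ, ‖x‖ ≤ 1 ∧ s = N x} (N (fun _ => 1)) ∧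
      Real.sqrt (2 / π) * N (fun _ => 1) ≤ ∫ x, N x ∂stdGaussian n := by
  have hconv := convexOn_univ_of_subadditive_of_abs_homogeneous hadd hsmul
  have hmax : ∀ x : Fin n → ℝ, ‖x‖ ≤ 1 → N x ≤ N fun _ => 1 :=
    fun x hx => unconditional_le_apply_one hconv hunc hx
  refine ⟨⟨⟨fun _ => 1, ?_, rfl⟩, ?_⟩, ?_⟩
  · exact (pi_norm_le_iff_of_nonneg zero_le_one).2 fun _ => by simp
  · rintro _ ⟨x, hx, rfl⟩
    exact hmax x hx
  · have hcont : ContinuousOn N Set.univ := hconv.continuousOn isOpen_univ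
    have hid : Integrable (fun t : ℝ => t) (gaussianReal 0 1) :=
      memLp_one_iff_integrable.1 (memLp_id_gaussianReal 1)
    have hint : Integrable (fun x : Fin n → ℝ => x) (_root_.stdGaussian n) :=
      Integrable.of_eval fun _ =>
        integrable_comp_eval (μ := fun _ : Fin n => gaussianReal 0 1) (f := fun t => t) hid
    have habs : ∀ i, Integrable (fun x : Fin n → ℝ => |x i|) (_root_.stdGaussian n) :=
      fun i => (hint.eval i).abs
    have hN : Integrable N (_root_.stdGaussian n) :=
      (hint.norm.const_mul (N fun _ => 1)).mono'
        (continuousOn_univ.1 hcont).aestronglyMeasurable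
        (.of_forall (abs_le_mul_norm_of_le_on_unit_ball hadd hsmul hmax))
    have hNabs : (N ∘ fun (x : Fin n → ℝ) i => |x i|) = N :=
      funext (unconditional_apply_abs hunc)
    have hmean : ∫ x, (fun i => |x i|) ∂_root_.stdGaussian n =
        √(2 / π) • fun _ : Fin n => (1 : ℝ) := by
      ext i
      rw [eval_integral habs, Pi.smul_apply, smul_eq_mul, mul_one, ← integral_abs_gaussianReal]
      exact integral_comp_eval (μ := fun _ : Fin n => gaussianReal 0 1)
        continuous_abs.aestronglyMeasurable
    have : IsProbabilityMeasure (_root_.stdGaussian n) := by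
      unfold _root_.stdGaussian; infer_instance
    have hjensen := hconv.map_integral_le hcont isClosed_univ (.of_forall fun _ => trivial)
      (Integrable.of_eval habs) (hNabs.symm ▸ hN)
    rw [hmean, hsmul, abs_of_nonneg (Real.sqrt_nonneg _)] at hjensen
    simpa only [unconditional_apply_abs hunc] using hjensen
end
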